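/- arXiv:1010.4133 — 4 statements merged into one kernel-verified Lean document; each statement's English description precedes it below -/
import Mathlib

section
/- Let n ≥ 2 and let f, h : S¹ → S¹ be orientation-preserving C¹ diffeomorphisms of the circle satisfying h ∘ f ∘ h⁻¹ = fⁿ. If the action of BS(1,n) on S¹ generated by f and h is faithful, then the rotation number ρ(h) of h is rational. -/
noncomputable section

/-- The circle `S¹ = ℝ/ℤ`. -/
abbrev S1 := AddCircle (1 : ℝ)

/-- `F` (a monotone degree-one lift, invertible, hence the lift of an orientation
preserving circle homeomorphism) is a lift of the circle map `g`. -/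
def IsLiftOf (F : CircleDeg1Liftˣ) (g : S1 ≃ₜ S1) : Prop :=
  ∀ x : ℝ, g (x : S1) = (((F : CircleDeg1Lift) x : ℝ) : S1)

/-- The lift is a `C¹` map with everywhere positive derivative, i.e. the corresponding
circle map is an orientation preserving `C¹` diffeomorphism. -/
def IsC1DiffeoLift (F : CircleDeg1Liftˣ) : Prop :=
  ContDiff ℝ 1 ⇑(F : CircleDeg1Lift) ∧ ∀ x : ℝ, 0 < deriv ⇑(F : CircleDeg1Lift) x

/-- The relator of the Baumslag–Solitar group `BS(1,n) = ⟨a,b | a b a⁻¹ = bⁿ⟩`,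
with `a` the generator `0` and `b` the generator `1` of the free group on two letters. -/
def bsRel (n : ℕ) : Set (FreeGroup (Fin 2)) :=
  {FreeGroup.of 0 * FreeGroup.of 1 * (FreeGroup.of 0)⁻¹ * ((FreeGroup.of 1) ^ n)⁻¹}

/-- The action of `BS(1,n)` generated by `h ≡ a` and `f ≡ b` is faithful:
every word in the free group on two letters that acts as the identity lies in the
normal closure of the Baumslag–Solitar relator, i.e. the induced homomorphism
`BS(1,n) → Homeo₊(S¹)` is injective. -/
def IsFaithfulBS (n : ℕ) (f h : S1 ≃ₜ S1) : Prop :=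
  ∀ w : FreeGroup (Fin 2),
    FreeGroup.lift ![h.toEquiv, f.toEquiv] w = 1 → w ∈ Subgroup.normalClosure (bsRel n)

/-- A circle diffeomorphism of class `C¹` almost preserves ratios of lengths of short intervals. -/
theorem IsC1DiffeoLift.exists_distortion {φ : CircleDeg1Liftˣ} (hφ : IsC1DiffeoLift φ)
    {θ : ℝ} (hθ : θ < 1) :
    ∃ δ > 0, ∀ u x y v : ℝ, u ≤ x → x < y → y ≤ v → v - u < δ →
      θ * (y - x) * (φ v - φ u) ≤ (φ y - φ x) * (v - u) ∧
      θ * (φ y - φ x) * (v - u) ≤ (y - x) * (φ v - φ u) := by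
  obtain ⟨hc, hpos⟩ := hφ
  have hd : Differentiable ℝ ⇑(φ : CircleDeg1Lift) := hc.differentiable one_ne_zero
  have hdc : Continuous (deriv ⇑(φ : CircleDeg1Lift)) := hc.continuous_deriv le_rfl
  have hper : ∀ (m : ℤ) (x : ℝ), deriv ⇑(φ : CircleDeg1Lift) (x - m) =
      deriv ⇑(φ : CircleDeg1Lift) x := by
    intro m x
    rw [← deriv_comp_sub_const]
    simp only [CircleDeg1Lift.map_sub_int, deriv_sub_const_fun]
  obtain ⟨z, -, hz⟩ := isCompact_Icc.exists_isMinOn (α := ℝ) (s := Set.Icc (-1 : ℝ) 2)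
    ⟨0, by norm_num⟩ hdc.continuousOn
  have hε : 0 < (1 - θ) * deriv ⇑(φ : CircleDeg1Lift) z := mul_pos (by linarith) (hpos z)
  obtain ⟨δ, hδ, hu⟩ := Metric.uniformContinuousOn_iff.1
    (isCompact_Icc.uniformContinuousOn_of_continuous
      (hdc.continuousOn (s := Set.Icc (-1 : ℝ) 2))) _ hε
  have key : ∀ c d : ℝ, |c - d| < min δ 1 →
      θ * deriv ⇑(φ : CircleDeg1Lift) d ≤ deriv ⇑(φ : CircleDeg1Lift) c := by
    intro c d hcd
    obtain ⟨h1, h2⟩ := lt_min_iff.1 hcd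
    rw [← hper ⌊c⌋ c, ← hper ⌊c⌋ d]
    have h3 := Int.floor_le c
    have h4 := Int.lt_floor_add_one c
    rw [abs_lt] at h2
    have hcm : c - ⌊c⌋ ∈ Set.Icc (-1 : ℝ) 2 := ⟨by linarith, by linarith⟩
    have hdm : d - ⌊c⌋ ∈ Set.Icc (-1 : ℝ) 2 := ⟨by linarith, by linarith⟩
    have h5 := hu _ hcm _ hdm (by rwa [Real.dist_eq, sub_sub_sub_cancel_right])
    rw [Real.dist_eq, abs_lt] at h5
    have h6 : deriv ⇑(φ : CircleDeg1Lift) z ≤ deriv ⇑(φ : CircleDeg1Lift) (d - ⌊c⌋) := hz hdm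
    nlinarith [mul_le_mul_of_nonneg_left h6 (by linarith : 0 ≤ 1 - θ)]
  refine ⟨min δ 1, lt_min hδ one_pos, fun u x y v hux hxy hyv hvu => ?_⟩
  obtain ⟨c, hc, hc'⟩ := exists_deriv_eq_slope (φ : CircleDeg1Lift) hxy
    hd.continuous.continuousOn hd.differentiableOn
  obtain ⟨d, hd, hd'⟩ := exists_deriv_eq_slope (φ : CircleDeg1Lift)
    (show u < v by linarith) hd.continuous.continuousOn hd.differentiableOn
  rw [eq_div_iff (by linarith)] at hc' hd'
  rw [← hc', ← hd']
  have hp : 0 < (y - x) * (v - u) := mul_pos (by linarith) (by linarith)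
  obtain ⟨hc1, hc2⟩ := hc
  obtain ⟨hd1, hd2⟩ := hd
  constructor
  · nlinarith [mul_le_mul_of_nonneg_right
      (key c d (abs_lt.2 ⟨by linarith, by linarith⟩)) hp.le]
  · nlinarith [mul_le_mul_of_nonneg_right
      (key d c (abs_lt.2 ⟨by linarith, by linarith⟩)) hp.le]

/-- Lower bound for the relative lengths of the images of an interval under `K^[k] ∘ G^[w]`,
`w < n ^ k`: such a map is a composition of `k` copies of `K` and at most `(n - 1) k` copies
of `G`. -/
theorem pow_mul_le_iterate_sub_iterate {n : ℕ} {G K : ℝ → ℝ} {a b θ : ℝ}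
    (hG : StrictMono G) (hK : StrictMono K) (hGK : ∀ x, G (K x) = K (G^[n] x)) (hn : 0 < n)
    (hab : a < b) (hθ₀ : 0 < θ) (hθ₁ : θ ≤ 1)
    (ha : ∀ j, G (K^[j] a) = K^[j] a) (hb : ∀ j, G (K^[j] b) = K^[j] b)
    (hdG : ∀ j x y, K^[j] a ≤ x → x < y → y ≤ K^[j] b → θ * (y - x) ≤ G y - G x)
    (hdK : ∀ j x y, K^[j] a ≤ x → x < y → y ≤ K^[j] b →
      θ * (y - x) * (K^[j + 1] b - K^[j + 1] a) ≤ (K y - K x) * (K^[j] b - K^[j] a))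
    (k : ℕ) : ∀ (j w : ℕ) (x y : ℝ), w < n ^ k → K^[j] a ≤ x → x < y → y ≤ K^[j] b →
      θ ^ (n * k) * (y - x) * (K^[j + k] b - K^[j + k] a) ≤
        (K^[k] (G^[w] y) - K^[k] (G^[w] x)) * (K^[j] b - K^[j] a) := by
  have hL : ∀ j, 0 < K^[j] b - K^[j] a := fun j => sub_pos.2 (hK.iterate j hab)
  have hiter : ∀ (w j : ℕ) (x y : ℝ), K^[j] a ≤ x → x < y → y ≤ K^[j] b →
      K^[j] a ≤ G^[w] x ∧ G^[w] x < G^[w] y ∧ G^[w] y ≤ K^[j] b ∧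
        θ ^ w * (y - x) ≤ G^[w] y - G^[w] x := by
    intro w j x y hx hxy hy
    induction w with
    | zero => simp [hx, hxy, hy]
    | succ w ih =>
      obtain ⟨h1, h2, h3, h4⟩ := ih
      simp only [Function.iterate_succ_apply']
      refine ⟨(ha j).symm.le.trans (hG.monotone h1), hG h2, (hG.monotone h3).trans (hb j).le, ?_⟩
      have h5 := hdG j _ _ h1 h2 h3
      calc θ ^ (w + 1) * (y - x) = θ * (θ ^ w * (y - x)) := by ring
        _ ≤ θ * (G^[w] y - G^[w] x) := by gcongr
        _ ≤ _ := h5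
  have hsemi : ∀ w x, K (G^[n * w] x) = G^[w] (K x) := by
    intro w x
    have h : Function.Semiconj K G^[n] G := fun x => (hGK x).symm
    rw [Function.iterate_mul]
    exact (h.iterate_right w) x
  induction k with
  | zero =>
    intro j w x y hw hx hxy hy
    obtain rfl : w = 0 := by simpa using hw
    simp
  | succ k ih =>
    intro j w x y hw hx hxy hy
    have hw' : w / n < n ^ k := Nat.div_lt_of_lt_mul (by rwa [pow_succ'] at hw)
    have hsplit : ∀ x, K^[k + 1] (G^[w] x) = K^[k] (G^[w / n] (K (G^[w % n] x))) := by
      intro x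
      conv_lhs => rw [← Nat.div_add_mod w n]
      rw [Function.iterate_succ_apply, Function.iterate_add_apply, hsemi]
    rw [hsplit, hsplit]
    obtain ⟨h1, h2, h3, h4⟩ := hiter (w % n) j x y hx hxy hy
    have h5 := hdK j _ _ h1 h2 h3
    have h6 := ih (j + 1) (w / n) (K (G^[w % n] x)) (K (G^[w % n] y)) hw'
      (by rw [Function.iterate_succ_apply']; exact hK.monotone h1) (hK h2)
      (by rw [Function.iterate_succ_apply']; exact hK.monotone h3)
    rw [show j + 1 + k = j + (k + 1) by ring] at h6
    have h7 : θ ^ n ≤ θ ^ (w % n + 1) :=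
      pow_le_pow_of_le_one hθ₀.le hθ₁ (Nat.mod_lt w hn)
    have h8 : θ ^ n * (y - x) * (K^[j + 1] b - K^[j + 1] a) ≤
        (K (G^[w % n] y) - K (G^[w % n] x)) * (K^[j] b - K^[j] a) := by
      refine le_trans ?_ h5
      have : θ ^ n * (y - x) ≤ θ * (G^[w % n] y - G^[w % n] x) := by
        calc θ ^ n * (y - x) ≤ θ ^ (w % n + 1) * (y - x) :=
              mul_le_mul_of_nonneg_right h7 (by linarith)
          _ = θ * (θ ^ (w % n) * (y - x)) := by ring
          _ ≤ _ := by gcongr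
      have := hL (j + 1)
      gcongr
    refine le_of_mul_le_mul_right ?_ (hL (j + 1))
    have hLk := hL (j + (k + 1))
    have hLj := hL j
    calc θ ^ (n * (k + 1)) * (y - x) * (K^[j + (k + 1)] b - K^[j + (k + 1)] a) *
          (K^[j + 1] b - K^[j + 1] a)
        = θ ^ (n * k) * (K^[j + (k + 1)] b - K^[j + (k + 1)] a) *
          (θ ^ n * (y - x) * (K^[j + 1] b - K^[j + 1] a)) := by ring
      _ ≤ θ ^ (n * k) * (K^[j + (k + 1)] b - K^[j + (k + 1)] a) *
          ((K (G^[w % n] y) - K (G^[w % n] x)) * (K^[j] b - K^[j] a)) := by gcongr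
      _ = θ ^ (n * k) * (K (G^[w % n] y) - K (G^[w % n] x)) *
          (K^[j + (k + 1)] b - K^[j + (k + 1)] a) * (K^[j] b - K^[j] a) := by ring
      _ ≤ _ := by
        rw [mul_right_comm _ (K^[j] b - K^[j] a) (K^[j + 1] b - K^[j + 1] a)]
        gcongr

/-- An affine-like action cannot have small distortion: the `n ^ k` intervals
`K^[k] (G^[w] [y, G y])`, `w < n ^ k`, do not fit into `K^[k] [a, b]` for large `k`. -/
theorem eq_of_small_distortion {n : ℕ} {G K : ℝ → ℝ} {a b θ y : ℝ}
    (hG : StrictMono G) (hK : StrictMono K) (hGK : ∀ x, G (K x) = K (G^[n] x)) (hn : 2 ≤ n)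
    (hab : a < b) (hθ₀ : 0 < θ) (hθ₁ : θ ≤ 1) (hθ : 3 / 4 ≤ θ ^ n)
    (ha : ∀ j, G (K^[j] a) = K^[j] a) (hb : ∀ j, G (K^[j] b) = K^[j] b)
    (hdG : ∀ j x y, K^[j] a ≤ x → x < y → y ≤ K^[j] b → θ * (y - x) ≤ G y - G x)
    (hdK : ∀ j x y, K^[j] a ≤ x → x < y → y ≤ K^[j] b →
      θ * (y - x) * (K^[j + 1] b - K^[j + 1] a) ≤ (K y - K x) * (K^[j] b - K^[j] a))
    (hay : a ≤ y) (hyb : y ≤ b) : G y = y := by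
  by_contra hne
  have hL : ∀ j, 0 < K^[j] b - K^[j] a := fun j => sub_pos.2 (hK.iterate j hab)
  have ha0 : G a = a := ha 0
  have hb0 : G b = b := hb 0
  have hmem : ∀ w, a ≤ G^[w] y ∧ G^[w] y ≤ b := by
    intro w
    constructor
    · conv_lhs => rw [← Function.iterate_fixed ha0 w]
      exact (hG.iterate w).monotone hay
    · conv_rhs => rw [← Function.iterate_fixed hb0 w]
      exact (hG.iterate w).monotone hyb
  have hstep : ∀ k w : ℕ, w < n ^ k →
      θ ^ (n * k) * |G y - y| * (K^[k] b - K^[k] a) ≤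
        SignType.sign (G y - y) * (K^[k] (G^[w + 1] y) - K^[k] (G^[w] y)) * (b - a) := by
    intro k w hw
    have hGy := hmem 1
    simp only [Function.iterate_one] at hGy
    rcases lt_or_gt_of_ne hne with hlt | hgt
    · have := pow_mul_le_iterate_sub_iterate hG hK hGK (by omega) hab hθ₀ hθ₁ ha hb hdG hdK k 0 w
        (G y) y hw hGy.1 hlt hyb
      rw [abs_of_neg (by linarith), sign_neg (by linarith), Function.iterate_succ_apply]
      simp only [zero_add, Function.iterate_zero, id] at this
      simpa using this
    · have := pow_mul_le_iterate_sub_iterate hG hK hGK (by omega) hab hθ₀ hθ₁ ha hb hdG hdK k 0 w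
        y (G y) hw hay hgt hGy.2
      rw [abs_of_pos (by linarith), sign_pos (by linarith), Function.iterate_succ_apply]
      simp only [zero_add, Function.iterate_zero, id] at this
      simpa using this
  have hsum : ∀ k : ℕ, (3 / 2 : ℝ) ^ k * |G y - y| ≤ b - a := by
    intro k
    have h1 := Finset.sum_le_sum fun w hw => hstep k w (Finset.mem_range.1 hw)
    rw [Finset.sum_const, Finset.card_range, nsmul_eq_mul, Nat.cast_pow, ← Finset.sum_mul,
      ← Finset.mul_sum, Finset.sum_range_sub (fun w => K^[k] (G^[w] y))] at h1
    have hm : ∀ w, K^[k] a ≤ K^[k] (G^[w] y) ∧ K^[k] (G^[w] y) ≤ K^[k] b := fun w =>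
      ⟨(hK.iterate k).monotone (hmem w).1, (hK.iterate k).monotone (hmem w).2⟩
    have h2 : (SignType.sign (G y - y) : ℝ) *
        (K^[k] (G^[n ^ k] y) - K^[k] (G^[0] y)) ≤ K^[k] b - K^[k] a := by
      have h3 := hm (n ^ k)
      have h4 := hm 0
      rcases lt_or_gt_of_ne hne with hlt | hgt
      · rw [sign_neg (by linarith)]
        simp only [SignType.coe_neg_one]
        linarith
      · rw [sign_pos (by linarith)]
        simp only [SignType.coe_one]
        linarith
    have h5 : (3 / 2 : ℝ) ^ k ≤ (n : ℝ) ^ k * θ ^ (n * k) := by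
      rw [pow_mul, ← mul_pow]
      have : (2 : ℝ) ≤ n := by exact_mod_cast hn
      refine pow_le_pow_left₀ (by norm_num) ?_ k
      nlinarith
    refine le_of_mul_le_mul_right ?_ (hL k)
    have hLk := hL k
    calc (3 / 2 : ℝ) ^ k * |G y - y| * (K^[k] b - K^[k] a)
        ≤ (n : ℝ) ^ k * θ ^ (n * k) * |G y - y| * (K^[k] b - K^[k] a) := by gcongr
      _ = (n : ℝ) ^ k * (θ ^ (n * k) * |G y - y| * (K^[k] b - K^[k] a)) := by ring
      _ ≤ _ := h1
      _ ≤ (K^[k] b - K^[k] a) * (b - a) := by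
        have : 0 ≤ b - a := by linarith
        gcongr
      _ = _ := mul_comm _ _
  have hpos : 0 < |G y - y| := abs_pos.2 (sub_ne_zero.2 hne)
  obtain ⟨k, hk⟩ := pow_unbounded_of_one_lt ((b - a) / |G y - y|) (by norm_num : (1 : ℝ) < 3 / 2)
  rw [div_lt_iff₀ hpos] at hk
  exact absurd (hsum k) (not_le.2 hk)

/-- Integer translates of pairwise distinct gaps of a closed periodic set have lengths
converging to zero. -/
theorem exists_forall_gap_lt {S : Set ℝ} (hS : ∀ (m : ℤ), ∀ x ∈ S, x + m ∈ S) {a b : ℕ → ℝ}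
    (ha : ∀ j, a j ∈ S) (hab : ∀ j, ∀ x ∈ Set.Ioo (a j) (b j), x ∉ S)
    (hinj : ∀ (i j : ℕ) (m : ℤ), a i = a j + m → i = j) {δ : ℝ} (hδ : 0 < δ) :
    ∃ N, ∀ j ≥ N, b j - a j < δ := by
  by_contra! hcon
  have hinf : {j | δ ≤ b j - a j}.Infinite :=
    Set.infinite_of_forall_exists_gt fun N => by
      obtain ⟨j, hj, hj'⟩ := hcon (N + 1)
      exact ⟨j, hj', by omega⟩
  have hmaps : Set.MapsTo (fun j => ⌊Int.fract (a j) / δ⌋) {j | δ ≤ b j - a j}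
      (Set.Icc 0 ⌊1 / δ⌋) := fun j _ =>
    ⟨Int.floor_nonneg.2 (div_nonneg (Int.fract_nonneg _) hδ.le), Int.floor_le_floor <| by
      gcongr
      exact (Int.fract_lt_one _).le⟩
  obtain ⟨i, hi, j, hj, hij, hfl⟩ := hinf.exists_ne_map_eq_of_mapsTo hmaps (Set.finite_Icc _ _)
  have hclose := Int.abs_sub_lt_one_of_floor_eq_floor hfl
  rw [← sub_div, abs_div, abs_of_pos hδ, div_lt_one hδ, Int.fract, Int.fract] at hclose
  have hlt : ∀ i j : ℕ, δ ≤ b i - a i → |a i - ⌊a i⌋ - (a j - ⌊a j⌋)| < δ →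
      a j - ⌊a j⌋ ≤ a i - ⌊a i⌋ := by
    intro i j hi hcl
    by_contra! hlt
    rw [abs_lt] at hcl
    refine hab i (a j + (⌊a i⌋ - ⌊a j⌋ : ℤ)) ⟨?_, ?_⟩ (hS _ _ (ha j)) <;> push_cast <;> linarith
  have h1 := hlt i j hi hclose
  have h2 := hlt j i hj (by rwa [abs_sub_comm])
  refine hij (hinj i j (⌊a i⌋ - ⌊a j⌋) ?_)
  push_cast
  linarith

theorem IsC1DiffeoLift.mul {φ ψ : CircleDeg1Liftˣ} (hφ : IsC1DiffeoLift φ)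
    (hψ : IsC1DiffeoLift ψ) : IsC1DiffeoLift (φ * ψ) := by
  refine ⟨hφ.1.comp hψ.1, fun x => ?_⟩
  have h := deriv_comp x (hφ.1.differentiable one_ne_zero (ψ x))
    (hψ.1.differentiable one_ne_zero x)
  rw [Units.val_mul, CircleDeg1Lift.coe_mul, h]
  exact mul_pos (hφ.2 _) (hψ.2 _)

theorem isC1DiffeoLift_translate (c : ℝ) :
    IsC1DiffeoLift (CircleDeg1Lift.translate (Multiplicative.ofAdd c)) := by
  have h : ⇑(CircleDeg1Lift.translate (Multiplicative.ofAdd c) : CircleDeg1Lift) =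
      fun x => c + x := funext fun x => CircleDeg1Lift.translate_apply c x
  rw [IsC1DiffeoLift, h]
  exact ⟨contDiff_const.add contDiff_id, fun x => by simp⟩

theorem IsC1DiffeoLift.pow {φ : CircleDeg1Liftˣ} (hφ : IsC1DiffeoLift φ) (k : ℕ) :
    IsC1DiffeoLift (φ ^ k) := by
  induction k with
  | zero => simpa using isC1DiffeoLift_translate 0
  | succ k ih => exact pow_succ φ k ▸ ih.mul hφ

theorem CircleDeg1Lift.units_strictMono (φ : CircleDeg1Liftˣ) :
    StrictMono ⇑(φ : CircleDeg1Lift) :=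
  (CircleDeg1Lift.strictMono_iff_injective _).2 (CircleDeg1Lift.toOrderIso φ).injective

theorem IsLiftOf.iterate {F : CircleDeg1Liftˣ} {f : S1 ≃ₜ S1} (hF : IsLiftOf F f) (k : ℕ)
    (x : ℝ) :
    (⇑f)^[k] (x : S1) = (((F ^ k : CircleDeg1Liftˣ) : CircleDeg1Lift) x : ℝ) := by
  rw [Units.val_pow_eq_pow_val, CircleDeg1Lift.coe_pow]
  induction k with
  | zero => rfl
  | succ k ih => rw [Function.iterate_succ_apply', Function.iterate_succ_apply', ih, hF]

/-- Two continuous real functions which agree modulo `1` differ by an integer constant. -/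
theorem exists_int_eq_add_of_coe_eq {u v : ℝ → ℝ} (hu : Continuous u) (hv : Continuous v)
    (h : ∀ x, (u x : S1) = (v x : S1)) : ∃ m : ℤ, ∀ x, u x = v x + m := by
  have hmaps : Set.MapsTo (fun x => u x - v x) Set.univ (Set.range ((↑) : ℤ → ℝ)) := by
    intro x _
    obtain ⟨m, hm⟩ := (AddCircle.coe_eq_zero_iff (1 : ℝ) (x := u x - v x)).1 (by
      rw [AddCircle.coe_sub, h, sub_self])
    exact ⟨m, by simpa using hm⟩
  obtain ⟨_, ⟨m, rfl⟩, hm⟩ := isPreconnected_univ.eqOn_const_of_mapsTo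
    Int.isClosedEmbedding_coe_real.isEmbedding.isDiscrete_range
    (hu.sub hv).continuousOn hmaps (Set.range_nonempty _)
  exact ⟨m, fun x => by have := hm (Set.mem_univ x); simp at this; linarith⟩

/-- The generator `b` of `BS(1,n)` has infinite order. -/
theorem pow_notMem_normalClosure_bsRel {n : ℕ} (hn : n ≠ 0) {k : ℕ} (hk : k ≠ 0) :
    FreeGroup.of 1 ^ k ∉ Subgroup.normalClosure (bsRel n) := by
  intro hmem
  let A : Equiv.Perm ℚ := Equiv.mulLeft₀ (n : ℚ) (by exact_mod_cast hn)
  let B : Equiv.Perm ℚ := Equiv.addRight 1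
  have hB : ∀ (j : ℕ) (x : ℚ), (B ^ j) x = x + j := by
    intro j x
    induction j with
    | zero => simp
    | succ j ih => rw [pow_succ', Equiv.Perm.mul_apply, ih]; simp [B, add_assoc]
  have hle : Subgroup.normalClosure (bsRel n) ≤ (FreeGroup.lift ![A, B]).ker := by
    refine Subgroup.normalClosure_le_normal ?_
    rintro _ rfl
    simp only [SetLike.mem_coe, MonoidHom.mem_ker, map_mul, map_inv, map_pow,
      FreeGroup.lift_apply_of]
    rw [mul_inv_eq_one, mul_inv_eq_iff_eq_mul]
    ext x
    simp only [Matrix.cons_val_zero, Matrix.cons_val_one, Equiv.Perm.mul_apply, hB]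
    simp [A, B, mul_add]
  have h := hle hmem
  rw [MonoidHom.mem_ker, map_pow, FreeGroup.lift_apply_of] at h
  have h0 : (B ^ k) 0 = 0 := DFunLike.congr_fun h 0
  rw [hB] at h0
  simp [hk] at h0

/-- A nontrivial `C¹` lift `G` with translation number zero which is conjugate to `G ^ n` by a
`C¹` lift `H` forces the translation number of `H` to be rational. -/
theorem exists_translationNumber_eq_rat {n : ℕ} (hn : 2 ≤ n) {G H : CircleDeg1Liftˣ}
    (hGc : IsC1DiffeoLift G) (hHc : IsC1DiffeoLift H) (hrel : H * G = G ^ n * H)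
    (hτ : CircleDeg1Lift.translationNumber (G : CircleDeg1Lift) = 0) (hG1 : G ≠ 1) :
    ∃ q : ℚ, CircleDeg1Lift.translationNumber (H : CircleDeg1Lift) = (q : ℝ) := by
  by_contra! hirr
  set g : ℝ → ℝ := ⇑(G : CircleDeg1Lift) with hg
  set K : ℝ → ℝ := ⇑((H⁻¹ : CircleDeg1Liftˣ) : CircleDeg1Lift) with hK
  have hgc : Continuous g := hGc.1.continuous
  have hgm : StrictMono g := CircleDeg1Lift.units_strictMono G
  have hKm : StrictMono K := CircleDeg1Lift.units_strictMono H⁻¹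
  have hHm : StrictMono ⇑(H : CircleDeg1Lift) := CircleDeg1Lift.units_strictMono H
  have hHK : ∀ x, (H : CircleDeg1Lift) (K x) = x := CircleDeg1Lift.units_apply_inv_apply H
  have hKH : ∀ x, K ((H : CircleDeg1Lift) x) = x := CircleDeg1Lift.units_inv_apply_apply H
  have hgK : ∀ x, g (K x) = K (g^[n] x) := by
    intro x
    have h1 : G * H⁻¹ = H⁻¹ * G ^ n := by
      rw [eq_inv_mul_iff_mul_eq, ← mul_assoc, hrel, mul_inv_cancel_right]
    have h2 := congrArg (fun φ : CircleDeg1Liftˣ => (φ : CircleDeg1Lift) x) h1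
    simpa [CircleDeg1Lift.coe_pow] using h2
  set S : Set ℝ := {x | g x = x} with hS
  have hSc : IsClosed S := isClosed_eq hgc continuous_id
  have hSadd : ∀ (m : ℤ), ∀ x ∈ S, x + m ∈ S := by
    intro m x hx
    change g (x + m) = x + m
    rw [hg, CircleDeg1Lift.map_add_int, ← hg, show g x = x from hx]
  have hSK : ∀ x, K x ∈ S ↔ x ∈ S := by
    intro x
    have := (G : CircleDeg1Lift).iterate_pos_eq_iff (x := x) (m := 0) (show 0 < n by omega)
    simp only [Int.cast_zero, mul_zero, add_zero] at this
    change g (K x) = K x ↔ g x = x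
    rw [hgK, hKm.injective.eq_iff]
    exact this
  obtain ⟨x₀, hx₀⟩ : S.Nonempty := by
    obtain ⟨x, hx⟩ := ((G : CircleDeg1Lift).translationNumber_eq_int_iff hgc (m := 0)).1
      (by simpa using hτ)
    exact ⟨x, hx.trans (by simp)⟩
  obtain ⟨p, hp⟩ : ∃ p, p ∉ S := by
    by_contra! h
    exact hG1 (Units.ext (CircleDeg1Lift.ext h))
  have hlo : (S ∩ Set.Iic p).Nonempty :=
    ⟨x₀ + ⌊p - x₀⌋, hSadd _ _ hx₀, by
      have := Int.floor_le (p - x₀)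
      simp only [Set.mem_Iic]
      linarith⟩
  have hhi : (S ∩ Set.Ici p).Nonempty :=
    ⟨x₀ + ⌈p - x₀⌉, hSadd _ _ hx₀, by
      have := Int.le_ceil (p - x₀)
      simp only [Set.mem_Ici]
      linarith⟩
  have hlob : BddAbove (S ∩ Set.Iic p) := ⟨p, fun x hx => hx.2⟩
  have hhib : BddBelow (S ∩ Set.Ici p) := ⟨p, fun x hx => hx.2⟩
  obtain ⟨haS, hap⟩ := (hSc.inter isClosed_Iic).csSup_mem hlo hlob
  obtain ⟨hbS, hbp⟩ := (hSc.inter isClosed_Ici).csInf_mem hhi hhib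
  have hgap₀ : ∀ x ∈ Set.Ioo (sSup (S ∩ Set.Iic p)) (sInf (S ∩ Set.Ici p)), x ∉ S := by
    rintro x ⟨hx1, hx2⟩ hx
    rcases le_total x p with h | h
    · exact absurd (le_csSup hlob ⟨hx, h⟩) (not_le.2 hx1)
    · exact absurd (csInf_le hhib ⟨hx, h⟩) (not_le.2 hx2)
  generalize sSup (S ∩ Set.Iic p) = a at *
  generalize sInf (S ∩ Set.Ici p) = b at *
  have hap' : a < p := lt_of_le_of_ne hap fun h => hp (h ▸ haS)
  have hbp' : p < b := lt_of_le_of_ne hbp fun h => hp (h ▸ hbS)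
  have hSiter : ∀ j x, x ∈ S ↔ K^[j] x ∈ S := by
    intro j x
    induction j with
    | zero => rfl
    | succ j ih => rw [Function.iterate_succ_apply', hSK, ih]
  have hgap : ∀ j, ∀ x ∈ Set.Ioo (K^[j] a) (K^[j] b), x ∉ S := by
    intro j
    induction j with
    | zero => exact hgap₀
    | succ j ih =>
      rintro x ⟨hx1, hx2⟩ hx
      rw [Function.iterate_succ_apply'] at hx1 hx2
      refine ih ((H : CircleDeg1Lift) x) ⟨?_, ?_⟩ ((hSK _).1 ((hKH x).symm ▸ hx))
      · simpa only [hHK] using hHm hx1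
      · simpa only [hHK] using hHm hx2
  have hlt_ne : ∀ (i j : ℕ) (m : ℤ), i < j → K^[i] a ≠ K^[j] a + m := by
    intro i j m hij h
    obtain ⟨d, rfl⟩ := Nat.exists_eq_add_of_lt hij
    have hinv : Function.LeftInverse (⇑(H : CircleDeg1Lift))^[d + 1] K^[d + 1] :=
      Function.LeftInverse.iterate hHK _
    have h1 := hinv (K^[i] a)
    rw [← Function.iterate_add_apply, show d + 1 + i = i + d + 1 by ring] at h1
    have h2 := CircleDeg1Lift.translationNumber_of_map_pow_eq_add_int (H : CircleDeg1Lift)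
      (x := K^[i + d + 1] a) (n := d + 1) (m := m)
      (by rw [CircleDeg1Lift.coe_pow, h1, h]) (Nat.succ_pos d)
    exact hirr (m / (d + 1 : ℕ)) (by rw [h2]; push_cast; rfl)
  have hinj : ∀ (i j : ℕ) (m : ℤ), K^[i] a = K^[j] a + m → i = j := by
    intro i j m h
    rcases lt_trichotomy i j with hij | hij | hij
    · exact absurd h (hlt_ne i j m hij)
    · exact hij
    · exact absurd (by rw [h]; push_cast; ring) (hlt_ne j i (-m) hij)
  have hn' : (2 : ℝ) ≤ n := by exact_mod_cast hn
  obtain ⟨θ, hθ₀, hθ₁, hθ⟩ : ∃ θ : ℝ, 0 < θ ∧ θ < 1 ∧ 3 / 4 ≤ θ ^ n := by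
    have hx : (1 : ℝ) / (4 * n) ≤ 1 / 8 := by
      gcongr; linarith
    have hx0 : (0 : ℝ) < 1 / (4 * n) := by positivity
    refine ⟨1 + -(1 / (4 * n)), by linarith, by linarith, ?_⟩
    refine le_trans (le_of_eq ?_) (one_add_mul_le_pow (by linarith) n)
    field_simp
    norm_num
  obtain ⟨δ₁, hδ₁, hd₁⟩ := hGc.exists_distortion hθ₁
  obtain ⟨δ₂, hδ₂, hd₂⟩ := hHc.exists_distortion hθ₁
  obtain ⟨N, hN⟩ := exists_forall_gap_lt hSadd (a := fun j => K^[j] a) (b := fun j => K^[j] b)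
    (fun j => (hSiter j a).1 haS) hgap hinj (lt_min hδ₁ hδ₂)
  have hadd : ∀ j x, K^[j] (K^[N] x) = K^[j + N] x := fun j x =>
    (Function.iterate_add_apply K j N x).symm
  refine hp ((hSiter N p).2 (eq_of_small_distortion hgm hKm hgK hn
    (hKm.iterate N (hap'.trans hbp'))
    hθ₀ hθ₁.le hθ (fun j => ?_) (fun j => ?_) (fun j x y hx hxy hy => ?_)
    (fun j x y hx hxy hy => ?_) (hKm.iterate N hap').le (hKm.iterate N hbp').le))
  · rw [hadd]; exact (hSiter _ a).1 haS
  · rw [hadd]; exact (hSiter _ b).1 hbS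
  · rw [hadd] at hx hy
    have h1 := (hd₁ _ x y _ hx hxy hy
      ((hN (j + N) (Nat.le_add_left _ _)).trans_le (min_le_left _ _))).1
    have h2 : (G : CircleDeg1Lift) (K^[j + N] a) = K^[j + N] a := (hSiter _ a).1 haS
    have h3 : (G : CircleDeg1Lift) (K^[j + N] b) = K^[j + N] b := (hSiter _ b).1 hbS
    rw [h2, h3] at h1
    exact le_of_mul_le_mul_right h1 (by linarith)
  · rw [hadd] at hx hy
    rw [hadd, hadd, hadd, hadd, show j + 1 + N = (j + N) + 1 by ring]
    have h1 := (hd₂ (K^[j + N + 1] a) (K x) (K y) (K^[j + N + 1] b)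
      (by rw [Function.iterate_succ_apply']; exact hKm.monotone hx) (hKm hxy)
      (by rw [Function.iterate_succ_apply']; exact hKm.monotone hy)
      ((hN (j + N + 1) (by omega)).trans_le (min_le_right _ _))).2
    rwa [Function.iterate_succ_apply' K (j + N) a, Function.iterate_succ_apply' K (j + N) b,
      hHK, hHK, hHK, hHK, ← Function.iterate_succ_apply' K, ← Function.iterate_succ_apply' K] at h1

/-- Let `n ≥ 2` and let `f, h` be orientation-preserving `C¹`
diffeomorphisms of the circle satisfying `h ∘ f ∘ h⁻¹ = fⁿ` (equivalently
`h ∘ f = fⁿ ∘ h`).  If the action of `BS(1,n)` generated by `f` and `h` is faithful,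
then the rotation number of `h` is rational. -/
theorem rotation_number_of_h_is_rational
    (n : ℕ) (hn : 2 ≤ n) (f h : S1 ≃ₜ S1) (F H : CircleDeg1Liftˣ)
    (hF : IsLiftOf F f) (hH : IsLiftOf H h)
    (hFc1 : IsC1DiffeoLift F) (hHc1 : IsC1DiffeoLift H)
    (hrel : ∀ x : S1, h (f x) = (⇑f)^[n] (h x))
    (hfaith : IsFaithfulBS n f h) :
    ∃ q : ℚ, CircleDeg1Lift.translationNumber (H : CircleDeg1Lift) = (q : ℝ) := by
  have hn1 : n - 1 + 1 = n := by omega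
  obtain ⟨m, hm⟩ := exists_int_eq_add_of_coe_eq
    (hHc1.mul hFc1).1.continuous ((hFc1.pow n).mul hHc1).1.continuous (fun x => by
      have h := hrel x
      rw [hF, hH, hH, hF.iterate] at h
      exact h)
  set T := CircleDeg1Lift.translate (Multiplicative.ofAdd (m : ℝ)) with hT
  have hTc : ∀ φ : CircleDeg1Liftˣ, Commute T φ := fun φ => Units.ext <|
    CircleDeg1Lift.ext fun x => by simp [hT]
  have hHF : H * F = T * F ^ n * H := Units.ext <| CircleDeg1Lift.ext fun x => by
    rw [hm x, mul_assoc, Units.val_mul T, CircleDeg1Lift.mul_apply,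
      CircleDeg1Lift.translate_apply, add_comm]
  have hτ : CircleDeg1Lift.translationNumber (F : CircleDeg1Lift) =
      m + n * CircleDeg1Lift.translationNumber (F : CircleDeg1Lift) := by
    have h1 := CircleDeg1Lift.translationNumber_conj_eq H (F : CircleDeg1Lift)
    rw [← Units.val_mul, ← Units.val_mul, hHF, mul_inv_cancel_right, Units.val_mul,
      CircleDeg1Lift.translationNumber_mul_of_commute
        (hTc (F ^ n)).units_val,
      CircleDeg1Lift.translationNumber_translate, Units.val_pow_eq_pow_val,
      CircleDeg1Lift.translationNumber_pow] at h1
    exact h1.symm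
  refine exists_translationNumber_eq_rat hn (G := T * F ^ (n - 1))
    ((isC1DiffeoLift_translate _).mul (hFc1.pow _)) hHc1 ?_ ?_ ?_
  · have h1 : H * F ^ (n - 1) * H⁻¹ = (T * F ^ n) ^ (n - 1) := by
      rw [← conj_pow, hHF, mul_inv_cancel_right]
    rw [← mul_inv_eq_iff_eq_mul]
    calc H * (T * F ^ (n - 1)) * H⁻¹ = T * (H * F ^ (n - 1) * H⁻¹) := by
          rw [← mul_assoc, ← (hTc H).eq]; group
      _ = T ^ (n - 1 + 1) * (F ^ (n - 1)) ^ n := by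
          rw [h1, (hTc _).mul_pow, pow_succ', mul_assoc, ← pow_mul, ← pow_mul, mul_comm n]
      _ = (T * F ^ (n - 1)) ^ n := by rw [hn1, (hTc _).mul_pow]
  · rw [Units.val_mul, CircleDeg1Lift.translationNumber_mul_of_commute
      (hTc (F ^ (n - 1))).units_val,
      CircleDeg1Lift.translationNumber_translate, Units.val_pow_eq_pow_val,
      CircleDeg1Lift.translationNumber_pow, Nat.cast_sub (by omega)]
    push_cast
    linarith
  · intro h1
    refine pow_notMem_normalClosure_bsRel (n := n) (by omega) (k := n - 1) (by omega) (hfaith _ ?_)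
    rw [map_pow, FreeGroup.lift_apply_of]
    ext z
    obtain ⟨x, rfl⟩ := QuotientAddGroup.mk_surjective z
    have h2 := congrArg (fun φ : CircleDeg1Liftˣ => (φ : CircleDeg1Lift) x) h1
    simp only [Units.val_mul, CircleDeg1Lift.mul_apply, hT, CircleDeg1Lift.translate_apply,
      Units.val_one, CircleDeg1Lift.coe_one, id] at h2
    have h3 := hF.iterate (n - 1) x
    simp only [Matrix.cons_val_one, Equiv.Perm.coe_one, id]
    rw [← Equiv.Perm.iterate_eq_pow]
    refine h3.trans ?_
    rw [eq_comm, ← sub_eq_zero, ← AddCircle.coe_sub, AddCircle.coe_eq_zero_iff]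
    exact ⟨m, by simp only [zsmul_eq_mul, mul_one]; linarith⟩
end
end

section
/- Let n ≥ 2 and let f, h : S¹ → S¹ be orientation-preserving C¹ diffeomorphisms of the circle satisfying h ∘ f ∘ h⁻¹ = fⁿ and generating a faithful action of BS(1,n). Then the rotation number of h is not irrational with minimal set a Cantor set; that is, h cannot be a Denjoy counterexample (an orientation-preserving circle diffeomorphism with irrational rotation number whose unique minimal invariant set is a Cantor set). -/
noncomputable section

/-- `K` is a minimal set of the circle homeomorphism `g` : a nonempty closed
`g`-invariant set all of whose nonempty closed invariant subsets coincide with it. -/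
def IsMinimalSet (g : S1 ≃ₜ S1) (K : Set S1) : Prop :=
  K.Nonempty ∧ IsClosed K ∧ (⇑g) '' K = K ∧
    ∀ K' ⊆ K, K'.Nonempty → IsClosed K' → (⇑g) '' K' = K' → K' = K

/-- A subset of the circle is a Cantor set: nonempty, perfect (closed without isolated
points) and totally disconnected. -/
def IsCantorSet (K : Set S1) : Prop :=
  K.Nonempty ∧ Perfect K ∧ IsTotallyDisconnected K

open Set Filter Topology

/-- A continuous `1`-periodic function has, up to an arbitrarily small error, Lipschitz growth. -/
theorem exists_abs_sub_le_of_periodic {φ : ℝ → ℝ} (hc : Continuous φ)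
    (hp : Function.Periodic φ 1) {ε : ℝ} (hε : 0 < ε) :
    ∃ C : ℝ, 0 ≤ C ∧ ∀ s t : ℝ, |φ s - φ t| ≤ ε + C * |s - t| := by
  have hK : IsCompact (Icc (-1 : ℝ) 2) := isCompact_Icc
  obtain ⟨M, hM⟩ := hK.exists_bound_of_continuousOn hc.continuousOn
  have huc := hK.uniformContinuousOn_of_continuous hc.continuousOn
  rw [Metric.uniformContinuousOn_iff] at huc
  obtain ⟨δ, hδ, hδ'⟩ := huc ε hε
  have hfl : ∀ s t : ℝ, φ (t - ⌊s⌋) = φ t := fun s t => by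
    simpa using hp.sub_zsmul_eq (x := t) ⌊s⌋
  have hM' : ∀ s, |φ s| ≤ M := fun s => by
    rw [← hfl s s]
    exact hM _ ⟨by linarith [Int.floor_le s], by linarith [Int.lt_floor_add_one s]⟩
  have hM0 : 0 ≤ M := (abs_nonneg _).trans (hM' 0)
  have hr : 0 < min δ 1 := lt_min hδ one_pos
  refine ⟨2 * M / min δ 1, by positivity, fun s t => ?_⟩
  rcases lt_or_ge |s - t| (min δ 1) with h | h
  · have h1 : |s - t| < 1 := h.trans_le (min_le_right _ _)
    rw [abs_lt] at h1
    have := hδ' (s - ⌊s⌋) ⟨by linarith [Int.floor_le s], by linarith [Int.lt_floor_add_one s]⟩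
      (t - ⌊s⌋) ⟨by linarith [Int.floor_le s], by linarith [Int.lt_floor_add_one s]⟩
      (by rw [Real.dist_eq, sub_sub_sub_cancel_right]; exact h.trans_le (min_le_left _ _))
    rw [hfl, hfl, Real.dist_eq] at this
    have : 0 ≤ 2 * M / min δ 1 * |s - t| := by positivity
    linarith
  · have h1 : 2 * M ≤ 2 * M / min δ 1 * |s - t| := by
      rw [div_mul_eq_mul_div, le_div_iff₀ hr]
      gcongr
    have := abs_sub (φ s) (φ t)
    linarith [hM' s, hM' t]

/-- Intervals which are pairwise disjoint modulo `1` have total length at most `1`. -/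
theorem sum_length_le_one {ι : Type*} (s : Finset ι) (a b : ι → ℝ)
    (hab : ∀ i ∈ s, a i ≤ b i) (hab1 : ∀ i ∈ s, b i ≤ a i + 1)
    (hd : ∀ i ∈ s, ∀ j ∈ s, i ≠ j → ∀ x ∈ Ioo (a i) (b i), ∀ y ∈ Ioo (a j) (b j),
      ∀ m : ℤ, x ≠ y + m) :
    ∑ i ∈ s, (b i - a i) ≤ 1 := by
  let B : ι → Set (AddCircle (1 : ℝ)) := fun i =>
    Metric.ball (((a i + b i) / 2 : ℝ) : AddCircle (1 : ℝ)) ((b i - a i) / 2)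
  have hB : ∀ i ∈ s, MeasureTheory.volume (B i) = ENNReal.ofReal (b i - a i) := by
    intro i hi
    rw [← MeasureTheory.measure_congr AddCircle.closedBall_ae_eq_ball, AddCircle.volume_closedBall]
    congr 1
    rw [min_eq_right] <;> linarith [hab1 i hi]
  have hlift : ∀ i, ∀ t : ℝ, (t : AddCircle (1 : ℝ)) ∈ B i →
      ∃ m : ℤ, t - m ∈ Ioo (a i) (b i) := by
    intro i t ht
    rw [mem_ball_iff_norm, ← AddCircle.coe_sub, AddCircle.norm_eq] at ht
    refine ⟨round (1⁻¹ * (t - (a i + b i) / 2)), ?_⟩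
    rw [abs_lt] at ht
    constructor <;> linarith
  have hdisj : Set.PairwiseDisjoint (s : Set ι) B := by
    intro i hi j hj hij
    refine Set.disjoint_left.2 fun t => ?_
    induction t using QuotientAddGroup.induction_on with
    | H t =>
      intro h1 h2
      obtain ⟨m, hm⟩ := hlift i t h1
      obtain ⟨k, hk⟩ := hlift j t h2
      exact hd i hi j hj hij _ hm _ hk (k - m) (by push_cast; ring)
  have h := MeasureTheory.measure_biUnion_finset (μ := MeasureTheory.volume) hdisj
    fun i _ => Metric.isOpen_ball.measurableSet
  have h2 : ∑ i ∈ s, ENNReal.ofReal (b i - a i) ≤ 1 := by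
    rw [← Finset.sum_congr rfl hB, ← h]
    refine (MeasureTheory.measure_mono (subset_univ _)).trans ?_
    rw [AddCircle.measure_univ]
    simp
  rw [← ENNReal.ofReal_sum_of_nonneg fun i hi => sub_nonneg.2 (hab i hi)] at h2
  simpa using h2

theorem iterate_apply_add_int (G : CircleDeg1Lift) (k : ℕ) (x : ℝ) (m : ℤ) :
    G^[k] (x + m) = G^[k] x + m := by
  rw [← CircleDeg1Lift.coe_pow, CircleDeg1Lift.map_add_int]

theorem iterate_length_le_one (G : CircleDeg1Lift) {a b : ℝ} (hb : b ≤ a + 1) (k : ℕ) :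
    G^[k] b ≤ G^[k] a + 1 := by
  have h := iterate_apply_add_int G k a 1
  rw [Int.cast_one] at h
  rw [← h]
  exact G.monotone.iterate k hb

/-- If the first `Q` images of an interval are disjoint from it modulo `1`, then
any `Q` consecutive images have total length at most `1`. -/
theorem sum_window_le_one {G : CircleDeg1Lift} (hG : Function.Bijective G) {a b : ℝ}
    (hab : a ≤ b) (hb : b ≤ a + 1) {Q : ℕ}
    (hQ : ∀ j, 1 ≤ j → j < Q → ∀ x ∈ Ioo a b, ∀ w ∈ Ioo a b, ∀ m : ℤ, G^[j] x ≠ w + m) (k : ℕ) :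
    ∑ i ∈ Finset.range Q, (G^[k + i] b - G^[k + i] a) ≤ 1 := by
  have hpre : ∀ i x, x ∈ Ioo (G^[i] a) (G^[i] b) → ∃ x' ∈ Ioo a b, G^[i] x' = x := by
    intro i x hx
    obtain ⟨x', rfl⟩ := hG.surjective.iterate i x
    exact ⟨x', ⟨(G.monotone.iterate i).reflect_lt hx.1, (G.monotone.iterate i).reflect_lt hx.2⟩,
      rfl⟩
  have hlt : ∀ i j, i < j → j < Q → ∀ x ∈ Ioo (G^[k + i] a) (G^[k + i] b),
      ∀ y ∈ Ioo (G^[k + j] a) (G^[k + j] b), ∀ m : ℤ, y ≠ x + m := by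
    intro i j hij hj x hx y hy m h
    obtain ⟨x', hx', rfl⟩ := hpre _ x hx
    obtain ⟨y', hy', rfl⟩ := hpre _ y hy
    rw [← iterate_apply_add_int, show k + j = k + i + (j - i) by omega,
      Function.iterate_add_apply] at h
    exact hQ (j - i) (by omega) (by omega) y' hy' x' hx' m (hG.injective.iterate _ h)
  refine sum_length_le_one _ (fun i => G^[k + i] a) (fun i => G^[k + i] b)
    (fun i _ => G.monotone.iterate _ hab) (fun i _ => iterate_length_le_one G hb _) ?_
  intro i hi j hj hij x hx y hy m h
  rw [Finset.mem_range] at hi hj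
  rcases lt_or_gt_of_ne hij with h' | h'
  · exact hlt i j h' hj x hx y hy (-m) (by rw [h]; push_cast; ring)
  · exact hlt j i h' hi y hy x hx m h

/-- Under exponential expansion of `H` along a backward orbit, the preimages of a short interval
around that orbit shrink to points. -/
theorem tendsto_length_zero {G H : CircleDeg1Lift} (hGH : ∀ x, G (H x) = x)
    (hHG : ∀ x, H (G x) = x) (hHd : Differentiable ℝ H) (hpos : ∀ x, 0 < deriv H x)
    {C : ℝ} (hC : 0 ≤ C)
    (hosc : ∀ s t, |Real.log (deriv H s) - Real.log (deriv H t)| ≤ 1 / 10 + C * |s - t|)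
    {a b : ℝ} (hab : a < b) (hb : b ≤ a + 1) {Q : ℕ} (hQ0 : 0 < Q) (hCQ : C ≤ Q / 10)
    (hQ : ∀ j, 1 ≤ j → j < Q → ∀ x ∈ Ioo a b, ∀ w ∈ Ioo a b, ∀ m : ℤ, G^[j] x ≠ w + m)
    {y : ℝ} (hy : y ∈ Icc a b) {D : ℕ → ℝ} (hD0 : ∀ k, 0 < D k) (hD1 : ∀ k, D k ≤ 1)
    (hD : ∀ k, Real.log (D k) + 1 / 3 - Real.log (deriv H (G^[k + 1] y)) ≤ Real.log (D (k + 1))) :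
    Tendsto (fun N => G^[N] b - G^[N] a) atTop (𝓝 0) := by
  have hG : Function.Bijective G := Function.bijective_iff_has_inverse.2 ⟨H, hHG, hGH⟩
  have hmono : StrictMono G := G.strictMono_iff_injective.2 hG.injective
  set l : ℕ → ℝ := fun N => G^[N] b - G^[N] a with hl
  have hl0 : ∀ k, 0 < l k := fun k => sub_pos.2 (hmono.iterate k hab)
  have hstep : ∀ k, Real.log (l (k + 1)) ≤
      Real.log (l k) - Real.log (deriv H (G^[k + 1] y)) + 1 / 10 + C * l (k + 1) := by
    intro k
    obtain ⟨ξ, hξ, hξ'⟩ := exists_deriv_eq_slope H (hmono.iterate (k + 1) hab)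
      hHd.continuous.continuousOn hHd.differentiableOn
    rw [eq_div_iff (hl0 (k + 1)).ne', Function.iterate_succ_apply', Function.iterate_succ_apply',
      hHG, hHG] at hξ'
    change deriv H ξ * l (k + 1) = l k at hξ'
    rw [← hξ', Real.log_mul (hpos _).ne' (hl0 _).ne']
    have h1 := hosc (G^[k + 1] y) ξ
    have h2 : |G^[k + 1] y - ξ| ≤ l (k + 1) := by
      have h3 := G.monotone.iterate (k + 1) hy.1
      have h4 := G.monotone.iterate (k + 1) hy.2
      rw [abs_le]
      constructor <;> simp only [hl] <;> linarith [hξ.1, hξ.2]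
    have := mul_le_mul_of_nonneg_left h2 hC
    linarith [le_abs_self (Real.log (deriv H (G^[k + 1] y)) - Real.log (deriv H ξ))]
  have hsum : ∀ N, Real.log (l N) - Real.log (D N) ≤ Real.log (l 0) - Real.log (D 0)
      - N * (7 / 30) + C * ∑ k ∈ Finset.range N, l (1 + k) := by
    intro N
    induction N with
    | zero => simp
    | succ N ih =>
      rw [Finset.sum_range_succ, mul_add, add_comm 1 N]
      push_cast
      linarith [hstep N, hD N]
  have hblock : ∀ t : ℕ, ∑ k ∈ Finset.range (Q * t), l (1 + k) ≤ t := by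
    intro t
    induction t with
    | zero => simp
    | succ t ih =>
      rw [mul_add, mul_one, Finset.sum_range_add]
      have := sum_window_le_one hG hab.le hb hQ (1 + Q * t)
      push_cast
      refine add_le_add ih ?_
      simpa only [hl, add_assoc] using this
  have hQr : (0 : ℝ) < Q := by exact_mod_cast hQ0
  have hwin : ∀ N : ℕ, ∑ k ∈ Finset.range N, l (1 + k) ≤ N / Q + 1 := by
    intro N
    have h1 : N ≤ Q * (N / Q + 1) := (Nat.lt_mul_div_succ N hQ0).le
    refine (Finset.sum_le_sum_of_subset_of_nonneg (Finset.range_mono h1)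
      fun i _ _ => (hl0 _).le).trans ((hblock _).trans ?_)
    push_cast
    linarith [Nat.cast_div_le (α := ℝ) (m := N) (n := Q)]
  have hfin : ∀ N : ℕ, l N ≤
      Real.exp (Real.log (l 0) - Real.log (D 0) + C - (2 / 15) * N) := by
    intro N
    rw [← Real.log_le_iff_le_exp (hl0 N)]
    have h1 := mul_le_mul_of_nonneg_left (hwin N) hC
    have h2 : C * (N / Q) ≤ N / 10 := by
      rw [mul_div_assoc', div_le_iff₀ hQr]
      have : (0 : ℝ) ≤ N := Nat.cast_nonneg N
      nlinarith
    have h3 : Real.log (D N) ≤ 0 := Real.log_nonpos (hD0 N).le (hD1 N)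
    linarith [hsum N]
  refine squeeze_zero (fun N => (hl0 N).le) hfin ?_
  refine Real.tendsto_exp_atBot.comp ?_
  refine tendsto_atBot_add_const_left _ _ (tendsto_neg_atTop_atBot.comp ?_)
  exact tendsto_natCast_atTop_atTop.const_mul_atTop (by norm_num)

/-- A point moved by `F` lies in a component of the complement of the fixed points of `F`. -/
theorem exists_gap {F : CircleDeg1Lift} (hF : Continuous F) {x₀ : ℝ} (hx₀ : F x₀ = x₀) {y : ℝ}
    (hy : F y ≠ y) : ∃ a b : ℝ, y ∈ Ioo a b ∧ b ≤ a + 1 ∧ F a = a ∧ F b = b ∧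
      ∀ x ∈ Ioo a b, F x ≠ x := by
  have hcl : IsClosed {x | F x = x} := isClosed_eq hF continuous_id
  have hfix : ∀ m : ℤ, F (x₀ + m) = x₀ + m := fun m => by rw [F.map_add_int, hx₀]
  have h1 := Int.floor_le (y - x₀)
  have h2 := Int.lt_floor_add_one (y - x₀)
  obtain ⟨a, ha⟩ := (isCompact_Icc.inter_right hcl).exists_isGreatest
    ⟨x₀ + ⌊y - x₀⌋, (⟨by linarith, by linarith⟩ : _ ∈ Icc (y - 1) y), hfix _⟩
  obtain ⟨b, hb⟩ := (isCompact_Icc.inter_right hcl).exists_isLeast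
    ⟨x₀ + (⌊y - x₀⌋ + 1 : ℤ), (⟨by push_cast; linarith, by push_cast; linarith⟩ :
      _ ∈ Icc y (y + 1)), hfix _⟩
  have haf : F a = a := ha.1.2
  have hbf : F b = b := hb.1.2
  have hay : a < y := lt_of_le_of_ne ha.1.1.2 (by rintro rfl; exact hy haf)
  have hyb : y < b := lt_of_le_of_ne hb.1.1.1 (by rintro rfl; exact hy hbf)
  refine ⟨a, b, ⟨hay, hyb⟩, ?_, haf, hbf, ?_⟩
  · refine hb.2 ⟨⟨by linarith [ha.1.1.1], by linarith⟩, ?_⟩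
    simp [F.map_add_one, haf]
  · intro x hx hxf
    rcases le_total x y with h | h
    · exact hx.1.not_ge (ha.2 ⟨⟨by linarith [ha.1.1.1, hx.1], h⟩, hxf⟩)
    · exact hx.2.not_ge (hb.2 ⟨⟨h, by linarith [hb.1.1.2, hx.2]⟩, hxf⟩)

theorem apply_eq_of_iterate_eq {F : CircleDeg1Lift} {n : ℕ} (hn : 0 < n) {x : ℝ}
    (h : F^[n] x = x) : F x = x := by
  have := (F.iterate_pos_eq_iff (x := x) (m := 0) hn).1 (by simpa using h)
  simpa using this

theorem exists_deriv_mul_eq {f : ℝ → ℝ} (hf : Differentiable ℝ f) (x y : ℝ) :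
    ∃ ξ ∈ uIcc x y, f y - f x = deriv f ξ * (y - x) := by
  have key : ∀ {x y : ℝ}, x < y → ∃ ξ ∈ Icc x y, f y - f x = deriv f ξ * (y - x) := by
    intro x y h
    obtain ⟨ξ, hξ, h'⟩ := exists_deriv_eq_slope f h hf.continuous.continuousOn hf.differentiableOn
    exact ⟨ξ, Ioo_subset_Icc_self hξ, by rw [h', div_mul_cancel₀ _ (sub_pos.2 h).ne']⟩
  rcases lt_trichotomy x y with h | rfl | h
  · rw [uIcc_of_le h.le]
    exact key h
  · exact ⟨x, left_mem_uIcc, by simp⟩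
  · rw [uIcc_of_ge h.le]
    obtain ⟨ξ, hξ, h'⟩ := key h
    exact ⟨ξ, hξ, by linarith⟩

theorem periodic_deriv (F : CircleDeg1Lift) : Function.Periodic (deriv F) 1 := by
  intro x
  rw [← deriv_comp_add_const]
  simp only [F.map_add_one, deriv_add_const]

theorem abs_iterate_sub_ge {F : CircleDeg1Lift} {n : ℕ} (hn : 2 ≤ n) {v c : ℝ}
    (hc : 9 / 10 ≤ c) (h : F (F v) - F v = c * (F v - v)) :
    19 / 10 * |F v - v| ≤ |F^[n] v - v| := by
  have h2 : F^[2] v = F (F v) := rfl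
  rcases le_total v (F v) with hv | hv
  · have := F.monotone.monotone_iterate_of_le_map hv hn
    rw [abs_of_nonneg (sub_nonneg.2 hv)]
    refine le_trans ?_ (le_abs_self _)
    nlinarith
  · have := F.monotone.antitone_iterate_of_map_le hv hn
    rw [abs_of_nonpos (sub_nonpos.2 hv)]
    refine le_trans ?_ (neg_le_abs _)
    nlinarith

/-- The displacement of `F` along a backward `H`-orbit outside the fixed points of `F` grows
faster than the derivative along that orbit. -/
theorem displacement_growth {F G H : CircleDeg1Lift} (hGH : ∀ x, G (H x) = x)
    (hHG : ∀ x, H (G x) = x) (hHd : Differentiable ℝ H) (hHc : Continuous (deriv H))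
    (hpos : ∀ x, 0 < deriv H x) (hFd : Differentiable ℝ F) (hFc : Continuous (deriv F))
    (hFs : StrictMono F) {n : ℕ} (hn : 2 ≤ n) (hrel : ∀ x, H (F x) = F^[n] (H x))
    (hirr : ∀ N : ℕ, 0 < N → ∀ x, ∀ m : ℤ, G^[N] x ≠ x + m)
    {x₀ : ℝ} (hx₀ : F x₀ = x₀) {y : ℝ} (hy : F y ≠ y) :
    (∀ k, 0 < |F (G^[k] y) - G^[k] y|) ∧ (∀ k, |F (G^[k] y) - G^[k] y| ≤ 1) ∧
    ∃ k₀, ∀ k ≥ k₀, Real.log |F (G^[k] y) - G^[k] y| + 1 / 3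
      - Real.log (deriv H (G^[k + 1] y)) ≤ Real.log |F (G^[k + 1] y) - G^[k + 1] y| := by
  have hG : Function.Bijective G := Function.bijective_iff_has_inverse.2 ⟨H, hHG, hGH⟩
  have hmono : StrictMono G := G.strictMono_iff_injective.2 hG.injective
  have hn0 : 0 < n := by omega
  have hfix1 : ∀ x, F (G x) = G x ↔ F x = x := by
    intro x
    constructor
    · intro h
      refine apply_eq_of_iterate_eq hn0 ?_
      have := hrel (G x)
      rwa [h, hHG, eq_comm] at this
    · intro h
      have := hrel (G x)
      rw [hHG, Function.iterate_fixed h] at this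
      rw [← hGH (F (G x)), this]
  have hfix : ∀ k x, F (G^[k] x) = G^[k] x ↔ F x = x := by
    intro k x
    induction k with
    | zero => rfl
    | succ k ih => rw [Function.iterate_succ_apply', hfix1, ih]
  obtain ⟨a, b, hyab, hb, haf, hbf, hno⟩ := exists_gap hFd.continuous hx₀ hy
  have hab : a < b := hyab.1.trans hyab.2
  have hdisj : ∀ j, 1 ≤ j → ∀ x ∈ Ioo a b, ∀ w ∈ Ioo a b, ∀ m : ℤ, G^[j] x ≠ w + m := by
    intro j hj x hx w hw m h
    rcases lt_trichotomy (G^[j] a) (a + m) with h' | h' | h'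
    · obtain ⟨u, hu⟩ := hG.surjective.iterate j (a + m)
      have hua : a < u := by
        rw [← hu] at h'
        exact (hmono.iterate j).lt_iff_lt.1 h'
      have hux : u < x := by
        refine (hmono.iterate j).lt_iff_lt.1 ?_
        rw [hu, h]
        linarith [hw.1]
      refine hno u ⟨hua, hux.trans hx.2⟩ ((hfix j u).1 ?_)
      rw [hu, F.map_add_int, haf]
    · exact hirr j hj a m h'
    · refine hno (G^[j] a - m) ⟨by linarith, ?_⟩ ?_
      · have := hmono.iterate j hx.1
        linarith [hw.2]
      · rw [F.map_sub_int, (hfix j a).2 haf]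
  set l : ℕ → ℝ := fun N => G^[N] b - G^[N] a with hl
  have hl0 : ∀ k, 0 < l k := fun k => sub_pos.2 (hmono.iterate k hab)
  have hlim : Tendsto l atTop (𝓝 0) := by
    refine (summable_of_sum_range_le (c := 1) (fun k => (hl0 k).le) fun N => ?_).tendsto_atTop_zero
    simpa only [zero_add] using sum_window_le_one hG hab.le hb (Q := N) (fun j hj _ => hdisj j hj) 0
  have hmem : ∀ k, G^[k] y ∈ Ioo (G^[k] a) (G^[k] b) := fun k =>
    ⟨hmono.iterate k hyab.1, hmono.iterate k hyab.2⟩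
  have hinv : ∀ k x, x ∈ Ioo (G^[k] a) (G^[k] b) → F x ∈ Ioo (G^[k] a) (G^[k] b) := by
    intro k x hx
    rw [← (hfix k a).2 haf, ← (hfix k b).2 hbf]
    exact ⟨hFs hx.1, hFs hx.2⟩
  have hDpos : ∀ k, 0 < |F (G^[k] y) - G^[k] y| := fun k =>
    abs_pos.2 (sub_ne_zero.2 fun h => hy ((hfix k y).1 h))
  refine ⟨hDpos, fun k => ?_, ?_⟩
  · have h1 := hmem k
    have h2 := hinv k _ h1
    have h3 := iterate_length_le_one G hb k
    rw [abs_le]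
    constructor <;> linarith [h1.1, h1.2, h2.1, h2.2]
  obtain ⟨C₁, hC₁, hosc₁⟩ := exists_abs_sub_le_of_periodic hFc (periodic_deriv F)
    (ε := 1 / 20) (by norm_num)
  obtain ⟨C₂, hC₂, hosc₂⟩ := exists_abs_sub_le_of_periodic
    (φ := fun x => Real.log (deriv H x)) (hHc.log fun x => (hpos x).ne')
    (fun x => by simp only [periodic_deriv H x]) (ε := 1 / 20) (by norm_num)
  have hev : ∀ᶠ k in atTop, C₁ * l k < 1 / 20 ∧ C₂ * l k < 1 / 20 := by
    have h1 : Tendsto (fun k => C₁ * l k) atTop (𝓝 0) := by simpa using hlim.const_mul C₁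
    have h2 : Tendsto (fun k => C₂ * l k) atTop (𝓝 0) := by simpa using hlim.const_mul C₂
    exact (h1.eventually_lt_const (by norm_num)).and (h2.eventually_lt_const (by norm_num))
  obtain ⟨k₀, hk₀⟩ := eventually_atTop.1 hev
  refine ⟨k₀, fun k hk => ?_⟩
  have hgap : ∀ (k : ℕ) (s t : ℝ), s ∈ Icc (G^[k] a) (G^[k] b) → t ∈ Icc (G^[k] a) (G^[k] b) →
      |s - t| ≤ l k := fun k s t hs ht => by
    rw [abs_le]
    constructor <;> simp only [hl] <;> linarith [hs.1, hs.2, ht.1, ht.2]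
  have hsub : ∀ k, uIcc (G^[k] y) (F (G^[k] y)) ⊆ Icc (G^[k] a) (G^[k] b) := fun k =>
    (ordConnected_Icc.uIcc_subset (Ioo_subset_Icc_self (hmem k))
      (Ioo_subset_Icc_self (hinv k _ (hmem k))))
  obtain ⟨η, hη, hη'⟩ := exists_deriv_eq_slope F (hmono.iterate k hab)
    hFd.continuous.continuousOn hFd.differentiableOn
  rw [(hfix k a).2 haf, (hfix k b).2 hbf, div_self (hl0 k).ne'] at hη'
  obtain ⟨ξ, hξ, hξ'⟩ := exists_deriv_mul_eq hFd (G^[k] y) (F (G^[k] y))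
  have hc : 9 / 10 ≤ deriv F ξ := by
    have h1 := hosc₁ η ξ
    have h2 := mul_le_mul_of_nonneg_left (hgap k η ξ (Ioo_subset_Icc_self hη) (hsub k hξ)) hC₁
    have h3 := (hk₀ k hk).1
    have h4 := le_abs_self (deriv F η - deriv F ξ)
    rw [hη'] at h1 h4
    linarith
  have hexp := abs_iterate_sub_ge hn hc hξ'
  obtain ⟨ζ, hζ, hζ'⟩ := exists_deriv_mul_eq hHd (G^[k + 1] y) (F (G^[k + 1] y))
  have hLζ : Real.log (deriv H ζ) ≤ Real.log (deriv H (G^[k + 1] y)) + 1 / 10 := by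
    have h1 := hosc₂ ζ (G^[k + 1] y)
    have h2 := mul_le_mul_of_nonneg_left (hgap (k + 1) ζ _ (hsub _ hζ)
      (Ioo_subset_Icc_self (hmem _))) hC₂
    have h3 := (hk₀ (k + 1) (by omega)).2
    have h4 := le_abs_self (Real.log (deriv H ζ) - Real.log (deriv H (G^[k + 1] y)))
    linarith
  have hHy : H (G^[k + 1] y) = G^[k] y := by rw [Function.iterate_succ_apply', hHG]
  rw [hrel, hHy] at hζ'
  rw [hζ', abs_mul, abs_of_pos (hpos ζ)] at hexp
  have hlog := Real.log_le_log (mul_pos (by norm_num) (hDpos k)) hexp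
  rw [Real.log_mul (by norm_num) (hDpos k).ne', Real.log_mul (hpos ζ).ne' (hDpos _).ne'] at hlog
  have hnum : 1 - (19 / 10 : ℝ)⁻¹ ≤ Real.log (19 / 10) :=
    Real.one_sub_inv_le_log_of_pos (by norm_num)
  norm_num at hnum
  linarith

/-- A point which is not periodic modulo `1` has a neighbourhood disjoint modulo `1` from its
first images. -/
theorem exists_radius_disjoint {G : CircleDeg1Lift} (hG : Continuous G)
    (hirr : ∀ N : ℕ, 0 < N → ∀ x, ∀ m : ℤ, G^[N] x ≠ x + m) (z : ℝ) (Q : ℕ) :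
    ∃ r : ℝ, 0 < r ∧ r ≤ 1 / 2 ∧ ∀ j, 1 ≤ j → j < Q → ∀ x ∈ Ioo (z - r) (z + r),
      ∀ w ∈ Ioo (z - r) (z + r), ∀ m : ℤ, G^[j] x ≠ w + m := by
  have hcoe : ∀ (x w : ℝ), ((x : AddCircle (1 : ℝ)) = w) ↔ ∃ m : ℤ, x = w + m := by
    intro x w
    rw [← sub_eq_zero, ← AddCircle.coe_sub, AddCircle.coe_eq_zero_iff]
    simp only [zsmul_eq_mul, mul_one]
    exact ⟨fun ⟨m, h⟩ => ⟨m, by linarith⟩, fun ⟨m, h⟩ => ⟨m, by linarith⟩⟩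
  have hev : ∀ᶠ p : ℝ × ℝ in 𝓝 (z, z), ∀ j ∈ Finset.Ico 1 Q,
      ((G^[j] p.1 : ℝ) : AddCircle (1 : ℝ)) ≠ (p.2 : AddCircle (1 : ℝ)) := by
    rw [Filter.eventually_all_finset]
    intro j hj
    have h1 : Continuous fun p : ℝ × ℝ => ((G^[j] p.1 : ℝ) : AddCircle (1 : ℝ)) :=
      (AddCircle.continuous_mk' 1).comp ((hG.iterate j).comp continuous_fst)
    have h2 : Continuous fun p : ℝ × ℝ => (p.2 : AddCircle (1 : ℝ)) :=
      (AddCircle.continuous_mk' 1).comp continuous_snd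
    refine (isOpen_ne_fun h1 h2).mem_nhds ?_
    intro h
    obtain ⟨m, hm⟩ := (hcoe _ _).1 h
    exact hirr j (Finset.mem_Ico.1 hj).1 z m hm
  obtain ⟨r, hr, hball⟩ := Metric.eventually_nhds_iff_ball.1 hev
  refine ⟨min r (1 / 2), by positivity, min_le_right _ _, fun j hj hjQ x hx w hw m h => ?_⟩
  have hin : ∀ x ∈ Ioo (z - min r (1 / 2)) (z + min r (1 / 2)), x ∈ Metric.ball z r := by
    intro x hx
    rw [Real.ball_eq_Ioo]
    have := min_le_left r (1 / 2)
    exact ⟨by linarith [hx.1], by linarith [hx.2]⟩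
  refine hball (x, w) ?_ j (Finset.mem_Ico.2 ⟨hj, hjQ⟩) ((hcoe _ _).2 ⟨m, h⟩)
  rw [← ball_prod_same]
  exact ⟨hin x hx, hin w hw⟩

/-- If `H` has no periodic points modulo `1` and conjugates `F` to `F ^ n`, where `F` has a fixed
point, then `F` is the identity. -/
theorem eq_self_of_conj_pow {F G H : CircleDeg1Lift} (hGH : ∀ x, G (H x) = x)
    (hHG : ∀ x, H (G x) = x) (hHd : Differentiable ℝ H) (hHc : Continuous (deriv H))
    (hpos : ∀ x, 0 < deriv H x) (hFd : Differentiable ℝ F) (hFc : Continuous (deriv F))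
    (hFs : StrictMono F) {n : ℕ} (hn : 2 ≤ n) (hrel : ∀ x, H (F x) = F^[n] (H x))
    (hirr : ∀ N : ℕ, 0 < N → ∀ x, ∀ m : ℤ, G^[N] x ≠ x + m)
    {x₀ : ℝ} (hx₀ : F x₀ = x₀) (y : ℝ) : F y = y := by
  by_contra hy
  have hG : Continuous G := G.continuous_iff_surjective.2 fun x => ⟨H x, hGH x⟩
  obtain ⟨hD0, hD1, k₀, hD⟩ :=
    displacement_growth hGH hHG hHd hHc hpos hFd hFc hFs hn hrel hirr hx₀ hy
  obtain ⟨C, hC, hosc⟩ := exists_abs_sub_le_of_periodic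
    (φ := fun x => Real.log (deriv H x)) (hHc.log fun x => (hpos x).ne')
    (fun x => by simp only [periodic_deriv H x]) (ε := 1 / 10) (by norm_num)
  obtain ⟨z, -, φ, hφ, hz⟩ := isCompact_Icc.tendsto_subseq
    (x := fun k => Int.fract (G^[k] y)) (s := Icc (0 : ℝ) 1)
    fun k => ⟨Int.fract_nonneg _, (Int.fract_lt_one _).le⟩
  obtain ⟨Q, hQ⟩ := exists_nat_gt (10 * C)
  have hQ0 : 0 < Q := by
    rw [← Nat.cast_pos (α := ℝ)]
    linarith
  obtain ⟨r, hr, hr2, hdisj⟩ := exists_radius_disjoint hG hirr z Q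
  obtain ⟨i₀, hi₀⟩ := Metric.tendsto_atTop.1 hz (r / 2) (by positivity)
  simp only [Function.comp_apply, Real.dist_eq] at hi₀
  set i := max i₀ k₀
  set p := φ i with hp
  have hpk : k₀ ≤ p := (le_max_right _ _).trans (hφ.id_le i)
  have hpz := abs_lt.1 (hi₀ i (le_max_left _ _))
  have horb : ∀ k, G^[k] (Int.fract (G^[p] y)) = G^[k + p] y - ⌊G^[p] y⌋ := by
    intro k
    have := iterate_apply_add_int G k (Int.fract (G^[p] y)) ⌊G^[p] y⌋
    rw [Int.fract_add_floor, ← Function.iterate_add_apply] at this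
    linarith
  have hlim := tendsto_length_zero (a := z - r) (b := z + r) hGH hHG hHd hpos hC hosc
    (by linarith) (by linarith) hQ0 (by linarith) hdisj (y := Int.fract (G^[p] y))
    ⟨by linarith, by linarith⟩ (D := fun k => |F (G^[k + p] y) - G^[k + p] y|)
    (fun k => hD0 _) (fun k => hD1 _) (fun k => by
      have h1 := hD (k + p) (by omega)
      have h2 := (periodic_deriv H).sub_zsmul_eq (x := G^[k + 1 + p] y) ⌊G^[p] y⌋
      rw [zsmul_eq_mul, mul_one] at h2
      rw [horb, h2]
      convert! h1 using 1
      all_goals rw [show k + 1 + p = k + p + 1 by omega])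
  obtain ⟨N₀, hN₀⟩ := Metric.tendsto_atTop.1 hlim (r / 2) (by positivity)
  set i' := max i₀ (p + N₀ + 1)
  have hi' : p + N₀ + 1 ≤ φ i' := (le_max_right _ _).trans (hφ.id_le i')
  have hqz := abs_lt.1 (hi₀ i' (le_max_left _ _))
  obtain ⟨N, hN⟩ : ∃ N, φ i' = N + p := ⟨φ i' - p, by omega⟩
  have hlen := hN₀ N (by omega)
  rw [dist_zero_right, Real.norm_eq_abs] at hlen
  have hlen' := (abs_lt.1 hlen).2
  have h1 := G.monotone.iterate N (show z - r ≤ Int.fract (G^[p] y) by linarith)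
  have h2 := G.monotone.iterate N (show Int.fract (G^[p] y) ≤ z + r by linarith)
  rw [horb, ← hN] at h1 h2
  set m : ℤ := ⌊G^[φ i'] y⌋ - ⌊G^[p] y⌋ with hm
  have hmr : (m : ℝ) = ⌊G^[φ i'] y⌋ - ⌊G^[p] y⌋ := by rw [hm]; push_cast; ring
  rw [Int.fract] at hqz
  obtain ⟨x, -, hx⟩ := intermediate_value_Icc' (f := fun x => G^[N] x - x - m)
    (show z - r ≤ z + r by linarith)
    (((hG.iterate N).sub continuous_id).sub continuous_const).continuousOn
    (show (0 : ℝ) ∈ Icc _ _ from ⟨by linarith, by linarith⟩)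
  exact hirr N (by omega) x m (by linarith)

/-- The lift `x ↦ m + F^p x`. -/
def powAdd (F : CircleDeg1Lift) (p : ℕ) (m : ℤ) : CircleDeg1Lift :=
  CircleDeg1Lift.translate (Multiplicative.ofAdd (m : ℝ)) * F ^ p

theorem powAdd_apply (F : CircleDeg1Lift) (p : ℕ) (m : ℤ) (x : ℝ) :
    powAdd F p m x = m + F^[p] x := by
  rw [powAdd, CircleDeg1Lift.mul_apply, CircleDeg1Lift.translate_apply, CircleDeg1Lift.coe_pow]

theorem iterate_powAdd_apply (F : CircleDeg1Lift) (p : ℕ) (m : ℤ) (k : ℕ) (x : ℝ) :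
    (powAdd F p m)^[k] x = k * m + F^[p * k] x := by
  induction k with
  | zero => simp
  | succ k ih =>
    have h := iterate_apply_add_int F p (F^[p * k] x) (k * m)
    push_cast at h
    rw [Function.iterate_succ_apply', ih, powAdd_apply, add_comm ((k : ℝ) * m), h,
      ← Function.iterate_add_apply, mul_add, mul_one, add_comm p]
    push_cast
    ring

theorem translationNumber_powAdd (F : CircleDeg1Lift) (p : ℕ) (m : ℤ) :
    CircleDeg1Lift.translationNumber (powAdd F p m) =
      m + p * CircleDeg1Lift.translationNumber F := by
  rw [powAdd, CircleDeg1Lift.translationNumber_mul_of_commute,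
    CircleDeg1Lift.translationNumber_translate, CircleDeg1Lift.translationNumber_pow]
  rw [CircleDeg1Lift.commute_iff_commute]
  intro x
  rw [CircleDeg1Lift.translate_apply, CircleDeg1Lift.translate_apply,
    CircleDeg1Lift.map_int_add]

theorem continuous_units (F : CircleDeg1Liftˣ) : Continuous (F : CircleDeg1Lift) :=
  (F : CircleDeg1Lift).continuous_iff_surjective.2 fun x =>
    ⟨_, CircleDeg1Lift.units_apply_inv_apply F x⟩

/-- Commutation modulo `1` of continuous maps lifts to the line up to a constant integer. -/
theorem exists_int_eq_add {u v : ℝ → ℝ} (hu : Continuous u) (hv : Continuous v)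
    (h : ∀ x, (u x : AddCircle (1 : ℝ)) = v x) : ∃ m : ℤ, ∀ x, u x = m + v x := by
  have h' : ∀ x, ∃ m : ℤ, (m : ℝ) = u x - v x := by
    intro x
    have := h x
    rw [← sub_eq_zero, ← AddCircle.coe_sub, AddCircle.coe_eq_zero_iff] at this
    simpa using this
  choose M hM using h'
  have hMc : Continuous M := by
    rw [Int.isClosedEmbedding_coe_real.isInducing.continuous_iff]
    exact (hu.sub hv).congr fun x => (hM x).symm
  refine ⟨M 0, fun x => ?_⟩
  rw [PreconnectedSpace.constant inferInstance hMc (x := 0) (y := x), hM]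
  ring

/-- The generator `b` of `BS(1, n)` has infinite order. -/
theorem of_one_pow_notMem_normalClosure {n : ℕ} (hn : n ≠ 0) {k : ℕ} (hk : k ≠ 0) :
    FreeGroup.of (1 : Fin 2) ^ k ∉ Subgroup.normalClosure (bsRel n) := by
  intro hmem
  let A : Equiv.Perm ℚ := Equiv.mulLeft₀ (n : ℚ) (by exact_mod_cast hn)
  let B : Equiv.Perm ℚ := Equiv.addRight 1
  have hB : ∀ (j : ℕ) (x : ℚ), (B ^ j) x = x + j := by
    intro j x
    rw [← Equiv.Perm.iterate_eq_pow]
    simp [B]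
  let ρ : FreeGroup (Fin 2) →* Equiv.Perm ℚ := FreeGroup.lift ![A, B]
  have hle : Subgroup.normalClosure (bsRel n) ≤ ρ.ker := by
    refine Subgroup.normalClosure_le_normal ?_
    rintro _ rfl
    rw [SetLike.mem_coe, MonoidHom.mem_ker]
    have hconj : A * B = B ^ n * A := by
      ext x
      simp only [Equiv.Perm.mul_apply, hB]
      simp [A, B, mul_add]
    simp [ρ, hconj]
  have h1 := hle hmem
  rw [MonoidHom.mem_ker, map_pow] at h1
  have h2 : (B ^ k) 0 = 0 := by
    have : ρ (FreeGroup.of 1) = B := by simp [ρ]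
    rw [← this, h1]
    rfl
  rw [hB, zero_add] at h2
  exact hk (by exact_mod_cast h2)

theorem iterate_lift_apply {F : CircleDeg1Liftˣ} {f : S1 ≃ₜ S1} (hF : IsLiftOf F f) (k : ℕ)
    (x : ℝ) : f^[k] (x : S1) = (((F : CircleDeg1Lift)^[k] x : ℝ) : S1) := by
  induction k with
  | zero => rfl
  | succ k ih => rw [Function.iterate_succ_apply', Function.iterate_succ_apply', ih, hF]

theorem contDiff_iterate {u : ℝ → ℝ} (hu : ContDiff ℝ 1 u) (k : ℕ) : ContDiff ℝ 1 u^[k] := by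
  induction k with
  | zero => exact contDiff_id
  | succ k ih => exact ih.comp hu

theorem iterate_inv_ne_add_int {H : CircleDeg1Liftˣ}
    (hirr : Irrational (CircleDeg1Lift.translationNumber (H : CircleDeg1Lift)))
    {N : ℕ} (hN : 0 < N) (x : ℝ) (m : ℤ) :
    (↑H⁻¹ : CircleDeg1Lift)^[N] x ≠ x + m := by
  intro h
  rw [← CircleDeg1Lift.coe_pow] at h
  have h2 := CircleDeg1Lift.translationNumber_of_map_pow_eq_add_int _ h hN
  rw [CircleDeg1Lift.translationNumber_units_inv] at h2
  refine hirr ⟨-((m : ℚ) / N), ?_⟩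
  push_cast
  rw [← h2, neg_neg]

/-- Let `n ≥ 2` and let `f, h` be orientation-preserving `C¹`
diffeomorphisms of the circle with `h ∘ f ∘ h⁻¹ = fⁿ` (equivalently `h ∘ f = fⁿ ∘ h`),
generating a faithful `BS(1,n)`-action.  Then `h` cannot be a Denjoy counterexample:
it is not the case that the rotation number of `h` is irrational and `h` has a minimal
set which is a Cantor set. -/
theorem h_is_not_Denjoy
    (n : ℕ) (hn : 2 ≤ n) (f h : S1 ≃ₜ S1) (F H : CircleDeg1Liftˣ)
    (hF : IsLiftOf F f) (hH : IsLiftOf H h)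
    (hFc1 : IsC1DiffeoLift F) (hHc1 : IsC1DiffeoLift H)
    (hrel : ∀ x : S1, h (f x) = (⇑f)^[n] (h x))
    (hfaith : IsFaithfulBS n f h) :
    ¬ (Irrational (CircleDeg1Lift.translationNumber (H : CircleDeg1Lift)) ∧
        ∃ K : Set S1, IsMinimalSet h K ∧ IsCantorSet K) := by
  rintro ⟨hirr, -⟩
  set G : CircleDeg1Lift := ↑H⁻¹
  obtain ⟨m, hm⟩ := exists_int_eq_add
    ((continuous_units H).comp (continuous_units F))
    (((continuous_units F).iterate n).comp (continuous_units H)) fun x => by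
      have := hrel x
      rwa [hF, hH, hH, iterate_lift_apply hF] at this
  have hsemi : Function.Semiconj H (F : CircleDeg1Lift) (powAdd F n m) := fun x => by
    rw [powAdd_apply]
    exact hm x
  set τ := CircleDeg1Lift.translationNumber (F : CircleDeg1Lift)
  have hτF : τ = m + n * τ := by
    rw [← translationNumber_powAdd]
    exact CircleDeg1Lift.translationNumber_eq_of_semiconj hsemi
  set F₁ : CircleDeg1Lift := powAdd F (n - 1) m with hF₁
  have hF₁eq : ⇑F₁ = fun x => m + (F : CircleDeg1Lift)^[n - 1] x :=
    funext fun x => powAdd_apply _ _ _ x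
  have hFinj : Function.Injective (F : CircleDeg1Lift) :=
    (CircleDeg1Lift.isUnit_iff_bijective.1 F.isUnit).injective
  have hF₁c1 : ContDiff ℝ 1 F₁ := by
    rw [hF₁eq]
    exact contDiff_const.add (contDiff_iterate hFc1.1 _)
  have hF₁mono : StrictMono F₁ := by
    rw [F₁.strictMono_iff_injective, hF₁eq]
    exact (add_right_injective _).comp (hFinj.iterate _)
  obtain ⟨x₀, hx₀⟩ : ∃ x₀, F₁ x₀ = x₀ := by
    obtain ⟨x, hx⟩ := F₁.exists_eq_add_translationNumber hF₁c1.continuous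
    refine ⟨x, ?_⟩
    rw [hx, hF₁, translationNumber_powAdd, Nat.cast_sub (by omega)]
    push_cast
    linarith
  have hrel₁ : ∀ x, (H : CircleDeg1Lift) (F₁ x) = F₁^[n] ((H : CircleDeg1Lift) x) := by
    intro x
    rw [hF₁, powAdd_apply, CircleDeg1Lift.map_int_add, iterate_powAdd_apply,
      (hsemi.iterate_right (n - 1)).eq, iterate_powAdd_apply, Nat.cast_sub (by omega), mul_comm n]
    push_cast
    ring
  have hid : ∀ y, F₁ y = y := eq_self_of_conj_pow (G := G) (CircleDeg1Lift.units_inv_apply_apply H)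
    (CircleDeg1Lift.units_apply_inv_apply H) (hHc1.1.differentiable one_ne_zero)
    (hHc1.1.continuous_deriv le_rfl) hHc1.2 (hF₁c1.differentiable one_ne_zero)
    (hF₁c1.continuous_deriv le_rfl) hF₁mono hn hrel₁
    (fun N hN x m => iterate_inv_ne_add_int hirr hN x m) hx₀
  refine of_one_pow_notMem_normalClosure (n := n) (k := n - 1) (by omega) (by omega)
    (hfaith _ ?_)
  ext t
  induction t using QuotientAddGroup.induction_on with
  | H x =>
    have h1 := hid x
    rw [hF₁eq] at h1
    have h2 : (F : CircleDeg1Lift)^[n - 1] x = x - m := by linarith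
    have h3 : f^[n - 1] (x : S1) = (x : S1) := by
      rw [iterate_lift_apply hF, h2, AddCircle.coe_sub, sub_eq_self, AddCircle.coe_eq_zero_iff]
      exact ⟨m, by simp⟩
    rw [map_pow, ← Equiv.Perm.iterate_eq_pow]
    simpa using h3
end
end

section
/- Let F and H be orientation-preserving homeomorphisms of the circle S¹ such that the rotation number of H is 0, the fixed point set Fix(F) of F is nonempty, and H maps Fix(F) into Fix(F). Then F and H have a common fixed point, i.e. Fix(F) ∩ Fix(H) ≠ ∅. -/
noncomputable section

open Filter Topology in
/-- The orbit of a point under a continuous monotone self-map of `ℝ` that stays between two fixed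
points of the map converges to a fixed point. -/
theorem Monotone.exists_tendsto_iterate_isFixedPt {h : ℝ → ℝ} (hmono : Monotone h)
    (hcont : Continuous h) {x b c : ℝ} (hb : h b = b) (hc : h c = c) (hbx : b ≤ x) (hxc : x ≤ c) :
    ∃ l, Tendsto (fun n => h^[n] x) atTop (𝓝 l) ∧ h l = l := by
  have hlow (n : ℕ) : b ≤ h^[n] x := by
    simpa only [Function.iterate_fixed hb] using hmono.iterate n hbx
  have hupp (n : ℕ) : h^[n] x ≤ c := by
    simpa only [Function.iterate_fixed hc] using hmono.iterate n hxc
  obtain ⟨l, hl⟩ : ∃ l, Tendsto (fun n => h^[n] x) atTop (𝓝 l) := by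
    rcases le_total x (h x) with hx | hx
    · exact ⟨_, tendsto_atTop_ciSup (hmono.monotone_iterate_of_le_map hx)
        ⟨c, Set.forall_mem_range.2 hupp⟩⟩
    · exact ⟨_, tendsto_atTop_ciInf (hmono.antitone_iterate_of_map_le hx)
        ⟨b, Set.forall_mem_range.2 hlow⟩⟩
  exact ⟨l, hl, isFixedPt_of_tendsto_iterate hl hcont.continuousAt⟩

/-- Let `F` and `H` be orientation-preserving circle homeomorphisms
such that the rotation number of `H` is `0` (in `ℝ/ℤ`), the fixed point set of `F` is
nonempty, and `H` maps `Fix F` into itself.  Then `F` and `H` have a common fixed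
point. -/
theorem common_fixed_point_of_invariant_fix
    (F H : S1 ≃ₜ S1) (FL HL : CircleDeg1Liftˣ)
    (hFL : IsLiftOf FL F) (hHL : IsLiftOf HL H)
    (hρ : ((CircleDeg1Lift.translationNumber (HL : CircleDeg1Lift) : ℝ) : S1) = 0)
    (hne : {q : S1 | F q = q}.Nonempty)
    (hinv : Set.MapsTo (⇑H) {q : S1 | F q = q} {q : S1 | F q = q}) :
    ∃ q : S1, F q = q ∧ H q = q := by
  obtain ⟨m, hm⟩ := AddCircle.coe_eq_zero_iff (1 : ℝ) |>.1 hρ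
  have hHcont : Continuous (HL : CircleDeg1Lift) :=
    (CircleDeg1Lift.toOrderIso HL).continuous
  obtain ⟨a, ha⟩ := CircleDeg1Lift.exists_eq_add_translationNumber (HL : CircleDeg1Lift) hHcont
  have ham : (HL : CircleDeg1Lift) a = a + m := by rw [ha, ← hm]; simp
  obtain ⟨q, hq⟩ := hne
  obtain ⟨x, rfl⟩ := QuotientAddGroup.mk_surjective q
  let h : ℝ → ℝ := fun y => (HL : CircleDeg1Lift) y - m
  have hproj (y : ℝ) : ((h y : ℝ) : S1) = H (y : S1) := by
    have hm0 : ((m : ℝ) : S1) = 0 := (AddCircle.coe_eq_zero_iff (1 : ℝ)).2 ⟨m, by simp⟩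
    rw [hHL y, AddCircle.coe_sub, hm0, sub_zero]
  have hfix (k : ℤ) : h (a + k) = a + k := by
    simp only [h, CircleDeg1Lift.map_add_int, ham]
    ring
  obtain ⟨l, hl, hhl⟩ := Monotone.exists_tendsto_iterate_isFixedPt (h := h) (x := x)
    (fun y z hyz => sub_le_sub_right ((HL : CircleDeg1Lift).monotone hyz) _)
    (hHcont.sub continuous_const) (hfix ⌊x - a⌋) (hfix ⌈x - a⌉)
    (by linarith [Int.floor_le (x - a)]) (by linarith [Int.le_ceil (x - a)])
  have horbit (n : ℕ) : ((h^[n] x : ℝ) : S1) ∈ {q : S1 | F q = q} := by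
    induction n with
    | zero => exact hq
    | succ n ih =>
      rw [Function.iterate_succ_apply', hproj]
      exact hinv ih
  have hclosed : IsClosed {q : S1 | F q = q} := isClosed_eq F.continuous continuous_id
  refine ⟨(l : S1), ?_, by rw [← hproj, hhl]⟩
  exact hclosed.mem_of_tendsto (((AddCircle.continuous_mk' (1 : ℝ)).tendsto l).comp hl)
    (Filter.Eventually.of_forall horbit)
end
end

section
/- Let n ≥ 2 and let f, h be orientation-preserving C¹ diffeomorphisms of the closed interval [0,1] satisfying h ∘ f ∘ h⁻¹ = fⁿ. Then there is no open subinterval J = (c,d) ⊂ (0,1) such that: the endpoints c and d are fixed by f, the restriction of f to J is not the identity, and J is a wandering interval for h in the sense that the intervals h^{−s}(J), s ≥ 0, are pairwise disjoint. -/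
noncomputable section

open Set

/-- `f : ℝ → ℝ` restricts to an orientation-preserving (increasing) `C¹`
diffeomorphism of the interval `[0,1]`. -/
def IsC1DiffeoOfI (f : ℝ → ℝ) : Prop :=
  ContDiffOn ℝ 1 f (Icc 0 1) ∧ StrictMonoOn f (Icc 0 1) ∧
    f 0 = 0 ∧ f 1 = 1 ∧ MapsTo f (Icc 0 1) (Icc 0 1) ∧ SurjOn f (Icc 0 1) (Icc 0 1) ∧
    ∀ x ∈ Icc (0 : ℝ) 1, 0 < derivWithin f (Icc 0 1) x

lemma IsC1DiffeoOfI.exists_slope_eq {φ : ℝ → ℝ} (hφ : IsC1DiffeoOfI φ) {x y : ℝ}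
    (hx : 0 ≤ x) (hxy : x < y) (hy : y ≤ 1) :
    ∃ z ∈ Ioo x y, φ y - φ x = derivWithin φ (Icc 0 1) z * (y - x) := by
  have hsub : Icc x y ⊆ Icc (0 : ℝ) 1 := Icc_subset_Icc hx hy
  have hd : DifferentiableOn ℝ φ (Icc 0 1) := hφ.1.differentiableOn one_ne_zero
  obtain ⟨z, hz, hzeq⟩ := exists_hasDerivAt_eq_slope φ (derivWithin φ (Icc 0 1)) hxy
    (hφ.1.continuousOn.mono hsub) (fun z hz =>
      (hd z (hsub (Ioo_subset_Icc_self hz))).hasDerivWithinAt.hasDerivAt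
        (Icc_mem_nhds (hx.trans_lt hz.1) (hz.2.trans_le hy)))
  refine ⟨z, hz, ?_⟩
  rw [hzeq, div_mul_cancel₀ _ (sub_pos.2 hxy).ne']

/-- The distortion of a `C¹` diffeomorphism on short intervals is arbitrarily close to `1`. -/
lemma IsC1DiffeoOfI.exists_small_distortion {φ : ℝ → ℝ} (hφ : IsC1DiffeoOfI φ) {θ : ℝ}
    (hθ1 : θ < 1) :
    ∃ δ > 0, ∀ c d : ℝ, 0 ≤ c → c < d → d ≤ 1 → d - c < δ →
      ∃ v > 0, ∀ x y : ℝ, c ≤ x → x ≤ y → y ≤ d →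
        θ * v * (y - x) ≤ φ y - φ x ∧ φ y - φ x ≤ v * (y - x) := by
  have hcont : ContinuousOn (derivWithin φ (Icc 0 1)) (Icc 0 1) :=
    hφ.1.continuousOn_derivWithin (uniqueDiffOn_Icc one_pos) le_rfl
  obtain ⟨p, hp, hmin⟩ := isCompact_Icc.exists_isMinOn (nonempty_Icc.2 zero_le_one) hcont
  set m := derivWithin φ (Icc 0 1) p
  have hm : 0 < m := hφ.2.2.2.2.2.2 p hp
  set e := (1 - θ) * m / 2 with he
  have he0 : 0 < e := by
    have := sub_pos.2 hθ1
    positivity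
  obtain ⟨δ, hδ, hunif⟩ := Metric.uniformContinuousOn_iff.1
    (isCompact_Icc.uniformContinuousOn_of_continuous hcont) e he0
  refine ⟨δ, hδ, fun c d hc hcd hd hlen => ?_⟩
  have hcI : c ∈ Icc (0 : ℝ) 1 := ⟨hc, hcd.le.trans hd⟩
  have hmc : m ≤ derivWithin φ (Icc 0 1) c := hmin hcI
  refine ⟨derivWithin φ (Icc 0 1) c + e, by linarith, fun x y hx hxy hy => ?_⟩
  rcases hxy.eq_or_lt with rfl | hxy
  · simp
  obtain ⟨z, hz, hslope⟩ := hφ.exists_slope_eq (hc.trans hx) hxy (hy.trans hd)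
  have hzc : c ≤ z := hx.trans hz.1.le
  have hzd : z ≤ d := hz.2.le.trans hy
  have hnear := hunif z ⟨hc.trans hzc, hzd.trans hd⟩ c hcI (by
    rw [Real.dist_eq, abs_of_nonneg (sub_nonneg.2 hzc)]
    linarith)
  rw [Real.dist_eq, abs_lt] at hnear
  rw [hslope]
  have hpos : 0 ≤ y - x := (sub_pos.2 hxy).le
  refine ⟨mul_le_mul_of_nonneg_right ?_ hpos, mul_le_mul_of_nonneg_right (by linarith) hpos⟩
  nlinarith [mul_le_mul_of_nonneg_left hmc (sub_pos.2 hθ1).le]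

lemma iterate_mul_comm_of_rel {n : ℕ} {f h : ℝ → ℝ} {S : Set ℝ} (hf : MapsTo f S S)
    (hrel : ∀ x ∈ S, h (f x) = f^[n] (h x)) (k : ℕ) {x : ℝ} (hx : x ∈ S) :
    h (f^[k] x) = f^[n * k] (h x) := by
  induction k with
  | zero => simp
  | succ k ih =>
    rw [Function.iterate_succ_apply', hrel _ (hf.iterate k hx), ih, ← Function.iterate_add_apply,
      Nat.mul_succ, add_comm]

lemma monotone_iterate_of_le {f : ℝ → ℝ} {S : Set ℝ} (hf : MapsTo f S S) (hmono : MonotoneOn f S)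
    {x : ℝ} (hx : x ∈ S) (hle : x ≤ f x) : Monotone fun k => f^[k] x := by
  refine monotone_nat_of_le_succ fun k => ?_
  induction k with
  | zero => simpa using hle
  | succ k ih =>
    simp only [Function.iterate_succ_apply'] at ih ⊢
    exact hmono (hf.iterate k hx) (hf (hf.iterate k hx)) ih

lemma antitone_iterate_of_le {f : ℝ → ℝ} {S : Set ℝ} (hf : MapsTo f S S) (hmono : MonotoneOn f S)
    {x : ℝ} (hx : x ∈ S) (hle : f x ≤ x) : Antitone fun k => f^[k] x := by
  refine antitone_nat_of_succ_le fun k => ?_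
  induction k with
  | zero => simpa using hle
  | succ k ih =>
    simp only [Function.iterate_succ_apply'] at ih ⊢
    exact hmono (hf (hf.iterate k hx)) (hf.iterate k hx) ih

lemma eq_of_iterate_eq {f : ℝ → ℝ} {S : Set ℝ} (hf : MapsTo f S S) (hmono : MonotoneOn f S)
    {n : ℕ} (hn : 1 ≤ n) {x : ℝ} (hx : x ∈ S) (hfix : f^[n] x = x) : f x = x := by
  rcases le_total x (f x) with hle | hle
  · exact le_antisymm (by simpa [hfix] using monotone_iterate_of_le hf hmono hx hle hn) hle
  · exact le_antisymm hle (by simpa [hfix] using antitone_iterate_of_le hf hmono hx hle hn)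

lemma tendsto_length_zero_of_disjoint {c d : ℕ → ℝ} (hc : ∀ t, 0 ≤ c t) (hd : ∀ t, d t ≤ 1)
    (hcd : ∀ t, c t < d t) (hdisj : Pairwise (Function.onFun Disjoint fun t => Ioo (c t) (d t))) :
    Filter.Tendsto (fun t => d t - c t) Filter.atTop (nhds 0) := by
  have hsum : ∑' t, ENNReal.ofReal (d t - c t) ≠ ⊤ := by
    have hU : ∑' t, ENNReal.ofReal (d t - c t) = MeasureTheory.volume (⋃ t, Ioo (c t) (d t)) := by
      rw [MeasureTheory.measure_iUnion hdisj fun t => measurableSet_Ioo]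
      simp
    have hle : MeasureTheory.volume (⋃ t, Ioo (c t) (d t)) ≤ MeasureTheory.volume (Icc (0 : ℝ) 1) :=
      MeasureTheory.measure_mono <| iUnion_subset fun t =>
        Ioo_subset_Icc_self.trans (Icc_subset_Icc (hc t) (hd t))
    rw [hU]
    exact (hle.trans_lt (by simp)).ne
  have hlim := (ENNReal.tendsto_toReal ENNReal.zero_ne_top).comp
    (ENNReal.tendsto_atTop_zero_of_tsum_ne_top hsum)
  refine hlim.congr fun t => ?_
  simp [(hcd t).le]

lemma le_iterate_sub_of_le_sub {f : ℝ → ℝ} {S : Set ℝ} (hf : MapsTo f S S) {θ : ℝ} (hθ : 0 ≤ θ)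
    (hexp : ∀ x ∈ S, ∀ y ∈ S, x ≤ y → θ * (y - x) ≤ f y - f x) (a : ℕ) {x y : ℝ}
    (hx : x ∈ S) (hy : y ∈ S) (hxy : x ≤ y) : θ ^ a * (y - x) ≤ f^[a] y - f^[a] x := by
  induction a with
  | zero => simp
  | succ a ih =>
    rw [Function.iterate_succ_apply', Function.iterate_succ_apply', pow_succ', mul_assoc]
    have hnn : 0 ≤ θ ^ a * (y - x) := mul_nonneg (pow_nonneg hθ a) (sub_nonneg.2 hxy)
    exact (mul_le_mul_of_nonneg_left ih hθ).trans
      (hexp _ (hf.iterate a hx) _ (hf.iterate a hy) (by linarith))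

/-- If a map `f` of `[0,1]` contracts the displacement of `x` under its iterates of order less
than `n ^ m` at most by the factor `(3 / 4) ^ m`, then `x` is fixed: otherwise the
displacements, which point in the same direction, would sum to more than `1`. -/
lemma eq_of_displacement_bound {f : ℝ → ℝ} (hf : MapsTo f (Icc 0 1) (Icc 0 1))
    (hmono : MonotoneOn f (Icc 0 1)) {n : ℕ} (hn : 2 ≤ n) {x : ℝ} (hx : x ∈ Icc (0 : ℝ) 1)
    (hbound : ∀ m k : ℕ, k < n ^ m →
      (3 / 4 : ℝ) ^ m * |f x - x| ≤ |f^[k + 1] x - f^[k] x|) : f x = x := by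
  by_contra hne
  have hpos : 0 < |f x - x| := abs_pos.2 (sub_ne_zero.2 hne)
  have hI : ∀ k, f^[k] x ∈ Icc (0 : ℝ) 1 := fun k => hf.iterate k hx
  have htotal : ∀ N, ∑ k ∈ Finset.range N, |f^[k + 1] x - f^[k] x| ≤ 1 := by
    intro N
    rcases le_total x (f x) with hle | hle
    · have hm := monotone_iterate_of_le hf hmono hx hle
      rw [Finset.sum_congr rfl fun k _ => abs_of_nonneg (sub_nonneg.2 (hm k.le_succ)),
        Finset.sum_range_sub fun k => f^[k] x]
      linarith [(hI N).2, (hI 0).1]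
    · have hm := antitone_iterate_of_le hf hmono hx hle
      rw [Finset.sum_congr rfl fun k _ =>
          (abs_sub_comm _ _).trans (abs_of_nonneg (sub_nonneg.2 (hm k.le_succ))),
        Finset.sum_range_sub' fun k => f^[k] x]
      linarith [(hI N).1, (hI 0).2]
  obtain ⟨m, hm⟩ := pow_unbounded_of_one_lt (1 / |f x - x|) (by norm_num : (1 : ℝ) < 3 / 2)
  rw [div_lt_iff₀ hpos] at hm
  have hlow : (n : ℝ) ^ m * ((3 / 4 : ℝ) ^ m * |f x - x|) ≤ 1 := by
    refine le_trans ?_ (htotal (n ^ m))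
    have := Finset.card_nsmul_le_sum (Finset.range (n ^ m))
      (fun k => |f^[k + 1] x - f^[k] x|) _ fun k hk => hbound m k (Finset.mem_range.1 hk)
    simpa [nsmul_eq_mul] using this
  have hgrow : (3 / 2 : ℝ) ^ m ≤ (n : ℝ) ^ m * (3 / 4 : ℝ) ^ m := by
    rw [← mul_pow]
    have : (2 : ℝ) ≤ n := by exact_mod_cast hn
    exact pow_le_pow_left₀ (by norm_num) (by linarith) m
  nlinarith [mul_le_mul_of_nonneg_right hgrow hpos.le]

/-- Let `n ≥ 2` and let `f, h` be orientation-preserving `C¹`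
diffeomorphisms of `[0,1]` with `h ∘ f ∘ h⁻¹ = fⁿ` (equivalently `h ∘ f = fⁿ ∘ h`
on `[0,1]`).  Then there is no open interval `J = (c,d) ⊆ (0,1)` whose endpoints are
fixed by `f`, on which `f` is not the identity, and which is wandering for `h`
(the preimages `h^{-s}(J)`, `s ≥ 0`, are pairwise disjoint). -/
theorem no_wandering_interval_fixed_by_f
    (n : ℕ) (hn : 2 ≤ n) (f h : ℝ → ℝ)
    (hf : IsC1DiffeoOfI f) (hh : IsC1DiffeoOfI h)
    (hrel : ∀ x ∈ Icc (0 : ℝ) 1, h (f x) = f^[n] (h x)) :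
    ¬ ∃ c d : ℝ, 0 ≤ c ∧ c < d ∧ d ≤ 1 ∧
        f c = c ∧ f d = d ∧
        (∃ x ∈ Ioo c d, f x ≠ x) ∧
        (∀ s t : ℕ, s ≠ t →
          Disjoint ((h^[s] ⁻¹' Ioo c d) ∩ Icc 0 1)
            ((h^[t] ⁻¹' Ioo c d) ∩ Icc 0 1)) := by
  rintro ⟨c, d, hc0, hcd, hd1, hfc, hfd, ⟨x₀, hx₀, hx₀ne⟩, hwand⟩
  obtain ⟨-, hfmono, -, -, hfI, -, -⟩ := id hf
  obtain ⟨-, hhmono, -, -, hhI, hhsurj, -⟩ := id hh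
  set g := Function.invFunOn h (Icc 0 1)
  have hgI : MapsTo g (Icc 0 1) (Icc 0 1) := hhsurj.mapsTo_invFunOn
  have hhg : ∀ x ∈ Icc (0 : ℝ) 1, h (g x) = x := fun x hx => hhsurj.rightInvOn_invFunOn hx
  have hgmono : StrictMonoOn g (Icc 0 1) := fun x hx y hy hxy => by
    rwa [← hhmono.lt_iff_lt (hgI hx) (hgI hy), hhg x hx, hhg y hy]
  have hcI : ∀ t, g^[t] c ∈ Icc (0 : ℝ) 1 := fun t => hgI.iterate t ⟨hc0, hcd.le.trans hd1⟩
  have hdI : ∀ t, g^[t] d ∈ Icc (0 : ℝ) 1 := fun t => hgI.iterate t ⟨hc0.trans hcd.le, hd1⟩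
  have hlt : ∀ t, g^[t] c < g^[t] d := fun t => by
    induction t with
    | zero => exact hcd
    | succ t ih =>
      rw [Function.iterate_succ_apply', Function.iterate_succ_apply']
      exact hgmono (hcI t) (hdI t) ih
  have hgfix : ∀ x ∈ Icc (0 : ℝ) 1, (f (g x) = g x ↔ f x = x) := fun x hx => by
    rw [← hhmono.injOn.eq_iff (hfI (hgI hx)) (hgI hx), hrel _ (hgI hx), hhg x hx]
    exact ⟨eq_of_iterate_eq hfI hfmono.monotoneOn (by omega) hx,
      fun hfix => Function.iterate_fixed hfix n⟩
  have hgfix_iterate : ∀ t, ∀ x ∈ Icc (0 : ℝ) 1, (f (g^[t] x) = g^[t] x ↔ f x = x) := by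
    intro t x hx
    induction t with
    | zero => rfl
    | succ t ih => rw [Function.iterate_succ_apply', hgfix _ (hgI.iterate t hx), ih]
  have hfct : ∀ t, f (g^[t] c) = g^[t] c := fun t => (hgfix_iterate t c (hcI 0)).2 hfc
  have hfdt : ∀ t, f (g^[t] d) = g^[t] d := fun t => (hgfix_iterate t d (hdI 0)).2 hfd
  have hsub : ∀ t, Icc (g^[t] c) (g^[t] d) ⊆ Icc 0 1 := fun t =>
    Icc_subset_Icc (hcI t).1 (hdI t).2
  have hfJ : ∀ t, MapsTo f (Icc (g^[t] c) (g^[t] d)) (Icc (g^[t] c) (g^[t] d)) := fun t x hx =>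
    ⟨by simpa [hfct t] using hfmono.monotoneOn (hcI t) (hsub t hx) hx.1,
      by simpa [hfdt t] using hfmono.monotoneOn (hsub t hx) (hdI t) hx.2⟩
  have hgJ : ∀ t, MapsTo g (Icc (g^[t] c) (g^[t] d)) (Icc (g^[t + 1] c) (g^[t + 1] d)) :=
    fun t x hx => by
      rw [Function.iterate_succ_apply', Function.iterate_succ_apply']
      exact ⟨hgmono.monotoneOn (hcI t) (hsub t hx) hx.1,
        hgmono.monotoneOn (hsub t hx) (hdI t) hx.2⟩
  have hpre : ∀ t, Ioo (g^[t] c) (g^[t] d) ⊆ (h^[t] ⁻¹' Ioo c d) ∩ Icc 0 1 := by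
    intro t x hx
    refine ⟨?_, hsub t (Ioo_subset_Icc_self hx)⟩
    induction t generalizing x with
    | zero => exact hx
    | succ t ih =>
      have hxI := hsub (t + 1) (Ioo_subset_Icc_self hx)
      rw [Function.iterate_succ_apply', Function.iterate_succ_apply'] at hx
      rw [mem_preimage, Function.iterate_succ_apply]
      refine ih ⟨?_, ?_⟩
      · simpa [hhg _ (hcI t)] using hhmono (hgI (hcI t)) hxI hx.1
      · simpa [hhg _ (hdI t)] using hhmono hxI (hgI (hdI t)) hx.2
  have hlen := tendsto_length_zero_of_disjoint (fun t => (hcI t).1) (fun t => (hdI t).2) hlt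
    fun s t hst => (hwand s t hst).mono (hpre s) (hpre t)
  set θ : ℝ := 1 - 1 / (4 * (n + 1)) with hθ
  have hθ1 : θ < 1 := by
    have : (0 : ℝ) < 1 / (4 * (n + 1)) := by positivity
    linarith
  have hθhalf : 1 / 2 ≤ θ := by
    have : (1 : ℝ) / (4 * (n + 1)) ≤ 1 / 2 :=
      one_div_le_one_div_of_le two_pos (by linarith [n.cast_nonneg (α := ℝ)])
    linarith
  have hθ0 : 0 < θ := by linarith
  have hθpow : 3 / 4 ≤ θ ^ (n + 1) := by
    have hB := one_add_mul_le_pow (a := θ - 1) (by linarith) (n + 1)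
    have : (1 : ℝ) + ((n + 1 : ℕ) : ℝ) * (θ - 1) = 3 / 4 := by
      rw [hθ]
      push_cast
      field_simp
      ring
    rw [this] at hB
    simpa using hB
  obtain ⟨δf, hδf, hdistf⟩ := hf.exists_small_distortion hθ1
  obtain ⟨δh, hδh, hdisth⟩ := hh.exists_small_distortion hθ1
  obtain ⟨T, hT⟩ := Filter.eventually_atTop.1
    (hlen.eventually (gt_mem_nhds (lt_min hδf hδh)))
  have hfexp : ∀ t ≥ T, ∀ x ∈ Icc (g^[t] c) (g^[t] d), ∀ y ∈ Icc (g^[t] c) (g^[t] d), x ≤ y →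
      θ * (y - x) ≤ f y - f x := by
    intro t ht x hx y hy hxy
    obtain ⟨v, hv, hvd⟩ := hdistf _ _ (hcI t).1 (hlt t) (hdI t).2
      ((hT t ht).trans_le (min_le_left _ _))
    have hv1 : 1 ≤ v := by
      have := (hvd _ _ le_rfl (hlt t).le le_rfl).2
      rw [hfct, hfdt] at this
      exact le_of_mul_le_mul_right (by simpa using this) (sub_pos.2 (hlt t))
    refine le_trans (mul_le_mul_of_nonneg_right ?_ (sub_nonneg.2 hxy)) (hvd x y hx.1 hxy hy.2).1
    exact le_mul_of_one_le_right hθ0.le hv1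
  have hmain : ∀ m t k : ℕ, T ≤ t → k < n ^ m →
      ∀ x ∈ Icc (g^[t] c) (g^[t] d), ∀ y ∈ Icc (g^[t] c) (g^[t] d), x ≤ y →
        (3 / 4 : ℝ) ^ m * (y - x) ≤ f^[k] y - f^[k] x := by
    intro m
    induction m with
    | zero =>
      intro t k _ hk x _ y _ _
      obtain rfl : k = 0 := by simpa using hk
      simp
    | succ m ih =>
      intro t k ht hk x hx y hy hxy
      have hk' : k / n < n ^ m := Nat.div_lt_of_lt_mul (by rwa [← pow_succ'])
      have ha : k % n < n := Nat.mod_lt _ (by omega)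
      have hsplit : ∀ z ∈ Icc (g^[t] c) (g^[t] d),
          f^[k] z = f^[k % n] (h (f^[k / n] (g z))) := fun z hz => by
        rw [iterate_mul_comm_of_rel hfI hrel _ (hgI (hsub t hz)), hhg z (hsub t hz),
          ← Function.iterate_add_apply, Nat.mod_add_div]
      have hhf : ∀ z ∈ Icc (g^[t] c) (g^[t] d),
          h (f^[k / n] (g z)) ∈ Icc (g^[t] c) (g^[t] d) := fun z hz => by
        rw [iterate_mul_comm_of_rel hfI hrel _ (hgI (hsub t hz)), hhg z (hsub t hz)]
        exact (hfJ t).iterate _ hz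
      have hgxy : g x ≤ g y := hgmono.monotoneOn (hsub t hx) (hsub t hy) hxy
      obtain ⟨v, hv, hvd⟩ := hdisth _ _ (hcI (t + 1)).1 (hlt (t + 1)) (hdI (t + 1)).2
        ((hT (t + 1) (by omega)).trans_le (min_le_right _ _))
      have hIH := ih (t + 1) (k / n) (by omega) hk' _ (hgJ t hx) _ (hgJ t hy) hgxy
      have hup := (hvd _ _ (hgJ t hx).1 hgxy (hgJ t hy).2).2
      rw [hhg x (hsub t hx), hhg y (hsub t hy)] at hup
      have hgap : 0 ≤ (3 / 4 : ℝ) ^ m * (g y - g x) :=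
        mul_nonneg (by positivity) (sub_nonneg.2 hgxy)
      have hlow := (hvd _ _ ((hfJ (t + 1)).iterate (k / n) (hgJ t hx)).1
        (by linarith : f^[k / n] (g x) ≤ f^[k / n] (g y))
        ((hfJ (t + 1)).iterate (k / n) (hgJ t hy)).2).1
      have hstep : θ * ((3 / 4 : ℝ) ^ m * (y - x)) ≤
          h (f^[k / n] (g y)) - h (f^[k / n] (g x)) :=
        calc θ * ((3 / 4 : ℝ) ^ m * (y - x))
            ≤ θ * ((3 / 4 : ℝ) ^ m * (v * (g y - g x))) := by gcongr
          _ = θ * v * ((3 / 4 : ℝ) ^ m * (g y - g x)) := by ring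
          _ ≤ θ * v * (f^[k / n] (g y) - f^[k / n] (g x)) := by gcongr
          _ ≤ _ := hlow
      have hgap' : 0 ≤ (3 / 4 : ℝ) ^ m * (y - x) :=
        mul_nonneg (by positivity) (sub_nonneg.2 hxy)
      rw [hsplit x hx, hsplit y hy]
      calc (3 / 4 : ℝ) ^ (m + 1) * (y - x) = 3 / 4 * ((3 / 4 : ℝ) ^ m * (y - x)) := by ring
        _ ≤ θ ^ (k % n + 1) * ((3 / 4 : ℝ) ^ m * (y - x)) := by
            refine mul_le_mul_of_nonneg_right (hθpow.trans ?_) hgap'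
            exact pow_le_pow_of_le_one hθ0.le hθ1.le (by omega)
        _ = θ ^ (k % n) * (θ * ((3 / 4 : ℝ) ^ m * (y - x))) := by ring
        _ ≤ θ ^ (k % n) * (h (f^[k / n] (g y)) - h (f^[k / n] (g x))) := by gcongr
        _ ≤ _ := le_iterate_sub_of_le_sub (hfJ t) hθ0.le (hfexp t ht) _ (hhf x hx) (hhf y hy)
            (sub_nonneg.1 ((mul_nonneg hθ0.le hgap').trans hstep))
  have hgx₀ : ∀ t, g^[t] x₀ ∈ Icc (g^[t] c) (g^[t] d) := fun t => by
    induction t with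
    | zero => exact Ioo_subset_Icc_self hx₀
    | succ t ih =>
      rw [Function.iterate_succ_apply' g t x₀]
      exact hgJ t ih
  refine hx₀ne ((hgfix_iterate T x₀ (hsub 0 (hgx₀ 0))).1
    (eq_of_displacement_bound hfI hfmono.monotoneOn hn (hsub T (hgx₀ T)) fun m k hk => ?_))
  have hfx := hfJ T (hgx₀ T)
  rw [Function.iterate_succ_apply]
  rcases le_total (g^[T] x₀) (f (g^[T] x₀)) with hle | hle
  · rw [abs_of_nonneg (sub_nonneg.2 hle)]
    exact (hmain m T k le_rfl hk _ (hgx₀ T) _ hfx hle).trans (le_abs_self _)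
  · rw [abs_sub_comm, abs_of_nonneg (sub_nonneg.2 hle), abs_sub_comm]
    exact (hmain m T k le_rfl hk _ hfx _ (hgx₀ T) hle).trans (le_abs_self _)
end
end
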